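/- arXiv:2301.05431 — 14 statements merged into one kernel-verified Lean document; each statement's English description precedes it below -/
import Mathlib

section
/- Let k be an integer with k > 1. If 2k−1 has a positive divisor d with d ≡ 3 (mod 8) or d ≡ −3 (mod 8), then the equation x² + (2k−1)^y = k^z has no solutions in positive integers (x, y, z) with y ∈ {3, 5}. -/
/-- Euler's criterion as a test for non-squares: some prime `p` in a fixed list has
`n ^ ((p - 1) / 2) ≡ -1` modulo `p`. -/
def eulerNonsquare (n : ℕ) : Bool :=
  [79, 31, 23, 71, 37, 67, 41, 83, 59, 7, 97, 17, 11, 47, 3, 5, 13, 19].any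
    fun p => n ^ ((p - 1) / 2) % p == p - 1

theorem sq_pow_mod_ne {p : ℕ} (hp : p.Prime) (h2 : 2 < p) (x : ℕ) :
    (x ^ 2) ^ ((p - 1) / 2) % p ≠ p - 1 := by
  have := Fact.mk hp
  have hodd : 2 * ((p - 1) / 2) = p - 1 := by
    have := hp.eq_two_or_odd
    omega
  rw [← pow_mul, hodd]
  by_cases hx : (x : ZMod p) = 0
  · have hdvd : p ∣ x := (ZMod.natCast_eq_zero_iff x p).1 hx
    have : x ^ (p - 1) % p = 0 :=
      Nat.mod_eq_zero_of_dvd (dvd_pow hdvd (by omega))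
    omega
  · have h1 : ((x ^ (p - 1) : ℕ) : ZMod p) = ((1 : ℕ) : ZMod p) := by
      push_cast
      exact ZMod.pow_card_sub_one_eq_one hx
    have h3 : x ^ (p - 1) % p = 1 % p := (ZMod.natCast_eq_natCast_iff _ _ _).1 h1
    rw [h3, Nat.mod_eq_of_lt (by omega)]
    omega

theorem eulerNonsquare_sq (x : ℕ) : eulerNonsquare (x ^ 2) = false := by
  by_contra h
  have h : eulerNonsquare (x ^ 2) = true := by simpa using h
  obtain ⟨p, hp, hx⟩ := List.any_eq_true.1 h
  have hprime : p.Prime ∧ 2 < p := by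
    simp only [List.mem_cons, List.not_mem_nil, or_false] at hp
    rcases hp with rfl | rfl | rfl | rfl | rfl | rfl | rfl | rfl | rfl | rfl | rfl | rfl | rfl |
      rfl | rfl | rfl | rfl | rfl <;> norm_num
  exact sq_pow_mod_ne hprime.1 hprime.2 x (by simpa using hx)

/-- A decidable certificate that `x² + (2k - 1)^y = k^(2m)` has no solution with `x > 0`. -/
def excluded (y m k : ℕ) : Bool :=
  decide (k ^ (2 * m) ≤ (2 * k - 1) ^ y) || eulerNonsquare (k ^ (2 * m) - (2 * k - 1) ^ y)

theorem not_excluded {x y m k : ℕ} (hx : 0 < x)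
    (h : x ^ 2 + (2 * k - 1) ^ y = k ^ (2 * m)) : excluded y m k = false := by
  have h1 : k ^ (2 * m) - (2 * k - 1) ^ y = x ^ 2 := by omega
  have h2 : ¬ k ^ (2 * m) ≤ (2 * k - 1) ^ y := by
    have : 0 < x ^ 2 := by positivity
    omega
  simp [excluded, h1, h2, eulerNonsquare_sq]

theorem excluded_three : ∀ m < 5, ∀ k < 16, 2 ≤ k → excluded 3 m k = true := by
  decide +kernel

theorem excluded_five : ∀ m < 10, ∀ k < 45, 2 ≤ k → excluded 5 m k = true := by
  decide +kernel

/-- Euler's criterion shows that `r ^ 6 - (2 * r - 1) ^ 5` is not a square modulo `p`. -/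
def nonresidueAt (p r : ℕ) : Bool :=
  (r ^ 6 + (p - 1) * (2 * r + (p - 1)) ^ 5) ^ ((p - 1) / 2) % p == p - 1

theorem nonresidueAt_eq_false {p x k r : ℕ} (hp : p.Prime) (h2 : 2 < p) (hk : 0 < k)
    (hr : r ≡ k [MOD p]) (h : x ^ 2 + (2 * k - 1) ^ 5 = k ^ 6) : nonresidueAt p r = false := by
  have hmod : r ^ 6 + (p - 1) * (2 * r + (p - 1)) ^ 5 ≡ x ^ 2 [MOD p] := by
    rw [← ZMod.natCast_eq_natCast_iff] at hr ⊢
    have h' := congrArg (Nat.cast : ℕ → ZMod p) h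
    push_cast [Nat.cast_sub (show 1 ≤ p by omega), Nat.cast_sub (show 1 ≤ 2 * k by omega)] at h' ⊢
    rw [hr, ← h']
    simp only [CharP.cast_eq_zero]
    ring
  have hne := sq_pow_mod_ne hp h2 x
  rw [← (hmod.pow ((p - 1) / 2) : _ % p = _ % p)] at hne
  simpa [nonresidueAt] using hne

theorem le_of_sq_add_pow_five_eq {x k : ℕ} (hk : 45 ≤ k)
    (h : x ^ 2 + (2 * k - 1) ^ 5 = k ^ 6) : 27200 ≤ k := by
  by_contra! hlt
  have key : ((List.range 50).all fun s => (List.range 49).all fun t =>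
      nonresidueAt 79 (49 * s + t) || nonresidueAt 31 (49 * s + t) ||
        (List.range 12).all fun i => decide (2449 * i + (49 * s + t) < 45) ||
          [23, 71, 37, 67, 41, 83, 59, 7, 97, 17, 11, 47].any
            fun p => nonresidueAt p (2449 * i + (49 * s + t))) = true := by
    decide +kernel
  have hmem := List.all_eq_true.1 (List.all_eq_true.1 key (k % 2449 / 49)
    (List.mem_range.2 (by omega))) (k % 2449 % 49) (List.mem_range.2 (by omega))
  have hr {p : ℕ} (hp : p ∣ 2449) : k % 2449 ≡ k [MOD p] := (Nat.mod_modEq k 2449).of_dvd hp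
  rw [Nat.div_add_mod, nonresidueAt_eq_false (by norm_num) (by norm_num) (by omega)
    (hr (by norm_num)) h, nonresidueAt_eq_false (by norm_num) (by norm_num) (by omega)
    (hr (by norm_num)) h, Bool.false_or, Bool.false_or] at hmem
  have hi := List.all_eq_true.1 hmem (k / 2449) (List.mem_range.2 (by omega))
  rw [Nat.div_add_mod, decide_eq_false (by omega), Bool.false_or] at hi
  obtain ⟨p, hp, hx⟩ := List.any_eq_true.1 hi
  have hprime : p.Prime ∧ 2 < p := by
    simp only [List.mem_cons, List.not_mem_nil, or_false] at hp
    rcases hp with rfl | rfl | rfl | rfl | rfl | rfl | rfl | rfl | rfl | rfl | rfl | rfl <;>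
      norm_num
  rw [nonresidueAt_eq_false hprime.1 hprime.2 (by omega) (Nat.ModEq.refl k) h] at hx
  exact Bool.false_ne_true hx

/-- If `x² + (2k - 1)^y = k^z` and `2k - 1` has a divisor congruent to `±3` modulo `8`,
then `z` is even. -/
theorem even_of_sq_add_pow_eq {k x : ℤ} {d y z : ℕ} (hdvd : (d : ℤ) ∣ 2 * k - 1)
    (hmod : d % 8 = 3 ∨ d % 8 = 5) (hy : 0 < y) (h : x ^ 2 + (2 * k - 1) ^ y = k ^ z) :
    Even z := by
  by_contra hz
  rw [Nat.not_even_iff_odd] at hz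
  have h2 : jacobiSym 2 d = -1 := by
    rw [jacobiSym.at_two (Nat.odd_iff.2 (by omega)), ZMod.χ₈_nat_mod_eight]
    rcases hmod with h | h <;> rw [h] <;> decide
  have hk : (2 * k) ^ z ≡ 1 [ZMOD d] := by
    have : (2 * k) ≡ 1 [ZMOD d] := ((Int.modEq_iff_dvd.2 hdvd)).symm
    simpa using this.pow z
  have hx : 2 ^ z * x ^ 2 ≡ (2 * k) ^ z [ZMOD d] := by
    rw [mul_pow, ← h]
    refine Int.modEq_iff_dvd.2 ?_
    have : (d : ℤ) ∣ 2 ^ z * (2 * k - 1) ^ y :=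
      (dvd_pow hdvd hy.ne').mul_left _
    convert this using 1
    ring
  have hJ := jacobiSym.mod_left' (hx.trans hk)
  rw [jacobiSym.mul_left, jacobiSym.pow_left, jacobiSym.pow_left, h2, hz.neg_one_pow,
    jacobiSym.one_left] at hJ
  nlinarith [sq_nonneg (jacobiSym x d)]

theorem two_mul_pow_le {k x N : ℤ} {m : ℕ} (hk : 0 < k) (hN : 0 < N)
    (h : x ^ 2 + N = k ^ (2 * m)) : 2 * k ^ m ≤ N + 1 := by
  have hK : 0 < k ^ m := by positivity
  have h1 : k ^ (2 * m) = (k ^ m) ^ 2 := by rw [mul_comm, pow_mul]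
  have h2 : |x| ≤ k ^ m - 1 := by
    have := abs_lt_of_sq_lt_sq (a := x) (b := k ^ m) (by linarith) hK.le
    omega
  have h3 : |x| ^ 2 ≤ (k ^ m - 1) ^ 2 := pow_le_pow_left₀ (abs_nonneg x) h2 2
  rw [sq_abs] at h3
  nlinarith

theorem false_of_sq_between {x P : ℤ} (hx : 0 ≤ x) (hP : 0 ≤ P) (h1 : P ^ 2 < x ^ 2)
    (h2 : x ^ 2 < (P + 1) ^ 2) : False := by
  have h3 := lt_of_pow_lt_pow_left₀ 2 hx h1
  have h4 := lt_of_pow_lt_pow_left₀ 2 (by omega) h2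
  omega

theorem no_solution_three {k m x : ℕ} (hk : 2 ≤ k) (hx : 0 < x) :
    (x : ℤ) ^ 2 + (2 * k - 1) ^ 3 ≠ k ^ (2 * m) := by
  intro h
  have hN : x ^ 2 + (2 * k - 1) ^ 3 = k ^ (2 * m) := by
    zify [show 1 ≤ 2 * k by omega]
    exact h
  have hne := not_excluded hx hN
  have hk' : (2 : ℤ) ≤ k := by exact_mod_cast hk
  have hD : (0 : ℤ) < (2 * k - 1) ^ 3 := pow_pos (by omega) 3
  have hb := two_mul_pow_le (by omega) hD h
  have hb2 : (k : ℤ) ^ m < 4 * k ^ 3 := by nlinarith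
  have hx0 : (0 : ℤ) ≤ x := by positivity
  have hb4 (h4 : m = 4) : (k : ℤ) ^ 4 < 4 * k ^ 3 := h4 ▸ hb2
  by_cases hm : m < 5
  · by_cases hk16 : k < 16
    · simp [excluded_three m hm k hk16 hk] at hne
    clear hne hN hb hb2 hD
    obtain ⟨t, rfl⟩ := Nat.exists_eq_add_of_le (not_lt.1 hk16)
    have t1 : (0 : ℤ) ≤ t := by positivity
    have t2 : (0 : ℤ) ≤ t ^ 2 := by positivity
    have t3 : (0 : ℤ) ≤ t ^ 3 := by positivity
    have t4 : (0 : ℤ) ≤ t ^ 4 := by positivity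
    have x2 : (0 : ℤ) ≤ x ^ 2 := by positivity
    interval_cases m <;> push_cast at h
    · linarith
    · linarith
    · refine false_of_sq_between (P := (16 + t : ℤ) ^ 2 - 4 * (16 + t) - 3) hx0 ?_ ?_ ?_ <;>
        linarith
    · refine false_of_sq_between (P := (16 + t : ℤ) ^ 3 - 4) hx0 ?_ ?_ ?_ <;> linarith
    · have := hb4 rfl
      push_cast at this
      linarith
  · have h5 : (k : ℤ) ^ 5 ≤ k ^ m := pow_le_pow_right₀ (by omega) (by omega)
    have h4 : (2 : ℤ) ^ 2 ≤ k ^ 2 := pow_le_pow_left₀ (by omega) hk' 2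
    nlinarith [mul_le_mul_of_nonneg_left h4 (show (0 : ℤ) ≤ k ^ 3 by positivity)]

theorem no_solution_five {k m x : ℕ} (hk : 2 ≤ k) (hx : 0 < x) :
    (x : ℤ) ^ 2 + (2 * k - 1) ^ 5 ≠ k ^ (2 * m) := by
  intro h
  have hN : x ^ 2 + (2 * k - 1) ^ 5 = k ^ (2 * m) := by
    zify [show 1 ≤ 2 * k by omega]
    exact h
  have hne := not_excluded hx hN
  have hk' : (2 : ℤ) ≤ k := by exact_mod_cast hk
  have hD : (0 : ℤ) < (2 * k - 1) ^ 5 := pow_pos (by omega) 5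
  have hb := two_mul_pow_le (by omega) hD h
  have hx0 : (0 : ℤ) ≤ x := by positivity
  have hb2 : (k : ℤ) ^ m ≤ 16 * k ^ 5 := by
    have : (2 * (k : ℤ) - 1) ^ 5 < (2 * k) ^ 5 :=
      pow_lt_pow_left₀ (by omega) (by omega) (by norm_num)
    have h5 : (0 : ℤ) < k ^ 5 := by positivity
    have e : (2 * (k : ℤ)) ^ 5 = 32 * k ^ 5 := by ring
    omega
  have hsmall (hlow : m < 3) : False := by
    have h4 : (k : ℤ) ^ (2 * m) ≤ k ^ 5 := pow_le_pow_right₀ (by omega) (by omega)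
    have : (k : ℤ) ^ 5 ≤ (2 * k - 1) ^ 5 := pow_le_pow_left₀ (by omega) (by omega) 5
    have : (0 : ℤ) < (x : ℤ) ^ 2 := by positivity
    linarith
  have h5 : (0 : ℤ) < k ^ 5 := by positivity
  by_cases hm : m < 10
  · by_cases hk45 : k < 45
    · simp [excluded_five m hm k hk45 hk] at hne
    by_cases hm6 : 6 ≤ m
    · have : (k : ℤ) ^ 6 ≤ k ^ m := pow_le_pow_right₀ (by omega) hm6
      have : (45 : ℤ) ≤ k := by omega
      nlinarith
    have hm3 : 3 ≤ m := by
      by_contra hlow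
      exact hsmall (by omega)
    have hm6 : m < 6 := by omega
    clear hne hb hb2 hD h5
    interval_cases m
    · obtain ⟨t, rfl⟩ :=
        Nat.exists_eq_add_of_le (le_of_sq_add_pow_five_eq (not_lt.1 hk45) hN)
      clear hN
      push_cast at h
      have t1 : (0 : ℤ) ≤ t := by positivity
      have t2 : (0 : ℤ) ≤ t ^ 2 := by positivity
      have t3 : (0 : ℤ) ≤ t ^ 3 := by positivity
      refine false_of_sq_between (P := (27200 + t : ℤ) ^ 3 - 16 * (27200 + t) ^ 2
        - 88 * (27200 + t) - 1449) hx0 ?_ ?_ ?_ <;> linarith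
    all_goals
      obtain ⟨t, rfl⟩ := Nat.exists_eq_add_of_le (not_lt.1 hk45)
      push_cast at h
      have t1 : (0 : ℤ) ≤ t := by positivity
      have t2 : (0 : ℤ) ≤ t ^ 2 := by positivity
      have t3 : (0 : ℤ) ≤ t ^ 3 := by positivity
      have t4 : (0 : ℤ) ≤ t ^ 4 := by positivity
      have t5 : (0 : ℤ) ≤ t ^ 5 := by positivity
    · refine false_of_sq_between (P := (45 + t : ℤ) ^ 4 - 16 * (45 + t) + 39) hx0 ?_ ?_ ?_ <;>
        linarith
    · refine false_of_sq_between (P := (45 + t : ℤ) ^ 5 - 16) hx0 ?_ ?_ ?_ <;> linarith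
  · have h10 : (k : ℤ) ^ 10 ≤ k ^ m := pow_le_pow_right₀ (by omega) (by omega)
    have h32 : (2 : ℤ) ^ 5 ≤ k ^ 5 := pow_le_pow_left₀ (by omega) hk' 5
    nlinarith

theorem stmt_0 (k : ℤ) (hk : 1 < k)
    (d : ℤ) (hd : 0 < d) (hdvd : d ∣ 2 * k - 1)
    (hmod : d % 8 = 3 ∨ d % 8 = 5) :
    ¬ ∃ (x y z : ℕ), 0 < x ∧ 0 < y ∧ 0 < z ∧ (y = 3 ∨ y = 5) ∧
      (x : ℤ) ^ 2 + (2 * k - 1) ^ y = k ^ z := by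
  rintro ⟨x, y, z, hx, hy, -, hy35, h⟩
  lift d to ℕ using hd.le
  lift k to ℕ using by omega
  obtain ⟨m, rfl⟩ := even_iff_two_dvd.1 (even_of_sq_add_pow_eq hdvd (by omega) hy h)
  rcases hy35 with rfl | rfl
  · exact no_solution_three (by omega) hx h
  · exact no_solution_five (by omega) hx h
end

section
/- Let k be an integer with k > 1. If k is a perfect square, then the equation x² + (2k−1)^y = k^z has no solutions in positive integers (x, y, z) with y ∈ {3, 5}. -/
theorem sq_ne_of_between {s x n : ℤ} (hs : 0 < s) (hlo : s ^ 2 < n) (hhi : n < (s + 1) ^ 2) :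
    x ^ 2 ≠ n := by
  rintro rfl
  have h1 : s < |x| := by simpa [abs_of_pos hs] using sq_lt_sq.mp hlo
  have h2 : |x| < s + 1 := by
    simpa [abs_of_pos (by linarith : 0 < s + 1)] using sq_lt_sq.mp hhi
  linarith

theorem not_isSquare_of_le_of_le : ∀ a ∈ Finset.Icc 2 200, ∀ z ∈ Finset.Icc 0 13,
    ∀ y ∈ ({3, 5} : Finset ℕ), (2 * a ^ 2 - 1) ^ y ≤ a ^ (2 * z) →
      ¬ IsSquare (a ^ (2 * z) - (2 * a ^ 2 - 1) ^ y) := by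
  decide +kernel

theorem sq_add_pow_ne_of_le_of_le {a x z y : ℕ} (ha : 2 ≤ a) (ha' : a ≤ 200) (hz : z ≤ 13)
    (hy : y = 3 ∨ y = 5) : (x : ℤ) ^ 2 + (2 * (a : ℤ) ^ 2 - 1) ^ y ≠ (a : ℤ) ^ (2 * z) := by
  intro h
  have hN : ((2 * a ^ 2 - 1 : ℕ) : ℤ) = 2 * (a : ℤ) ^ 2 - 1 := by
    have : 1 ≤ 2 * a ^ 2 := by nlinarith
    push_cast [Nat.cast_sub this]
    ring
  rw [← hN] at h
  have h' : x ^ 2 + (2 * a ^ 2 - 1) ^ y = a ^ (2 * z) := by exact_mod_cast h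
  refine not_isSquare_of_le_of_le a (by simp [ha, ha']) z (by simp [hz]) y (by simpa using hy)
    (by omega) ⟨x, ?_⟩
  rw [← sq]
  omega

/-- A number below the gap between `(A - 1) ^ 2` and `A ^ 2` is not `A ^ 2` minus a square. -/
theorem sq_add_ne_of_lt {A x n : ℤ} (hn : 0 < n) (h : n < 2 * A - 1) :
    x ^ 2 + n ≠ A ^ 2 := by
  intro hx
  exact sq_ne_of_between (s := A - 1) (x := x) (n := A ^ 2 - n) (by omega) (by linarith)
    (by linarith) (by linarith)

theorem lt_of_sq_add_pow_eq {a x N : ℤ} {y z : ℕ} (ha : 2 ≤ a) (hN : a ^ 2 < N) (hy : y ≠ 0)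
    (h : x ^ 2 + N ^ y = a ^ (2 * z)) : y < z := by
  by_contra! hzy
  have h1 : a ^ (2 * z) ≤ (a ^ 2) ^ y := by
    rw [← pow_mul]
    exact pow_le_pow_right₀ (by linarith) (by omega)
  have h2 : (a ^ 2) ^ y < N ^ y := pow_lt_pow_left₀ hN (by positivity) hy
  nlinarith [sq_nonneg x]

theorem sq_add_cube_ne {a x : ℤ} {z : ℕ} (ha : 200 < a) :
    x ^ 2 + (2 * a ^ 2 - 1) ^ 3 ≠ a ^ (2 * z) := by
  intro h
  have hz := lt_of_sq_add_pow_eq (by linarith) (by nlinarith) (by norm_num) h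
  obtain ⟨t, rfl⟩ : ∃ t, a = t + 200 := ⟨a - 200, by ring⟩
  have ht : 0 < t := by linarith
  rcases (by omega : z = 4 ∨ z = 5 ∨ z = 6 ∨ 7 ≤ z) with rfl | rfl | rfl | hz
  · refine sq_ne_of_between (s := (t + 200) ^ 4 - 4 * (t + 200) ^ 2 - 3) ?_ ?_ ?_
      (eq_sub_of_add_eq h)
    all_goals (rw [← sub_pos]; ring_nf; positivity)
  · refine sq_ne_of_between (s := (t + 200) ^ 5 - 4 * (t + 200)) ?_ ?_ ?_ (eq_sub_of_add_eq h)
    all_goals (rw [← sub_pos]; ring_nf; positivity)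
  · refine sq_ne_of_between (s := (t + 200) ^ 6 - 4) ?_ ?_ ?_ (eq_sub_of_add_eq h)
    all_goals (rw [← sub_pos]; ring_nf; positivity)
  · have h7 : (t + 200) ^ 7 ≤ (t + 200) ^ z := pow_le_pow_right₀ (by linarith) hz
    have hN : (2 * (t + 200) ^ 2 - 1) ^ 3 < 2 * (t + 200) ^ 7 - 1 := by
      rw [← sub_pos]; ring_nf; positivity
    rw [mul_comm 2 z, pow_mul] at h
    refine sq_add_ne_of_lt (pow_pos (by nlinarith) 3) ?_ h
    linarith

theorem sq_add_pow_five_ne {a x : ℤ} {z : ℕ} (ha : 200 < a) :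
    x ^ 2 + (2 * a ^ 2 - 1) ^ 5 ≠ a ^ (2 * z) := by
  intro h
  have hz := lt_of_sq_add_pow_eq (by linarith) (by nlinarith) (by norm_num) h
  obtain ⟨t, rfl⟩ : ∃ t, a = t + 200 := ⟨a - 200, by ring⟩
  have ht : 0 < t := by linarith
  rcases (by omega : z = 6 ∨ z = 7 ∨ z = 8 ∨ z = 9 ∨ z = 10 ∨ 11 ≤ z) with
    rfl | rfl | rfl | rfl | rfl | hz
  · refine sq_ne_of_between
      (s := (t + 200) ^ 6 - 16 * (t + 200) ^ 4 - 88 * (t + 200) ^ 2 - 1449) ?_ ?_ ?_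
      (eq_sub_of_add_eq h)
    all_goals (rw [← sub_pos]; ring_nf; positivity)
  · refine sq_ne_of_between
      (s := (t + 200) ^ 7 - 16 * (t + 200) ^ 3 + 40 * (t + 200) - 1) ?_ ?_ ?_
      (eq_sub_of_add_eq h)
    all_goals (rw [← sub_pos]; ring_nf; positivity)
  · refine sq_ne_of_between (s := (t + 200) ^ 8 - 16 * (t + 200) ^ 2 + 39) ?_ ?_ ?_
      (eq_sub_of_add_eq h)
    all_goals (rw [← sub_pos]; ring_nf; positivity)
  · refine sq_ne_of_between (s := (t + 200) ^ 9 - 16 * (t + 200)) ?_ ?_ ?_ (eq_sub_of_add_eq h)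
    all_goals (rw [← sub_pos]; ring_nf; positivity)
  · refine sq_ne_of_between (s := (t + 200) ^ 10 - 16) ?_ ?_ ?_ (eq_sub_of_add_eq h)
    all_goals (rw [← sub_pos]; ring_nf; positivity)
  · have h11 : (t + 200) ^ 11 ≤ (t + 200) ^ z := pow_le_pow_right₀ (by linarith) hz
    have hN : (2 * (t + 200) ^ 2 - 1) ^ 5 < 2 * (t + 200) ^ 11 - 1 := by
      rw [← sub_pos]; ring_nf; positivity
    rw [mul_comm 2 z, pow_mul] at h
    refine sq_add_ne_of_lt (pow_pos (by nlinarith) 5) ?_ h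
    linarith

theorem sq_add_pow_ne_of_fourteen_le {a x : ℤ} {y z : ℕ} (ha : 2 ≤ a) (hz : 14 ≤ z)
    (hy : y ≤ 5) : x ^ 2 + (2 * a ^ 2 - 1) ^ y ≠ a ^ (2 * z) := by
  rw [mul_comm 2 z, pow_mul]
  have hN : 1 < 2 * a ^ 2 - 1 := by nlinarith
  refine sq_add_ne_of_lt (by positivity) ?_
  calc (2 * a ^ 2 - 1) ^ y ≤ (2 * a ^ 2 - 1) ^ 5 := pow_le_pow_right₀ hN.le hy
    _ < 2 * a ^ 14 - 1 := by
      obtain ⟨t, rfl⟩ : ∃ t, a = t + 2 := ⟨a - 2, by ring⟩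
      have ht : 0 ≤ t := by linarith
      rw [← sub_pos]; ring_nf; positivity
    _ ≤ 2 * a ^ z - 1 := by
      linarith [pow_le_pow_right₀ (by linarith : 1 ≤ a) hz]

theorem stmt_1 (k : ℤ) (hk : 1 < k) (hsq : IsSquare k) :
    ¬ ∃ (x y z : ℕ), 0 < x ∧ 0 < y ∧ 0 < z ∧ (y = 3 ∨ y = 5) ∧
      (x : ℤ) ^ 2 + (2 * k - 1) ^ y = k ^ z := by
  rintro ⟨x, y, z, -, -, -, hy, h⟩
  obtain ⟨r, rfl⟩ := hsq
  obtain ⟨a, ha⟩ : ∃ a : ℕ, r * r = (a : ℤ) ^ 2 := ⟨r.natAbs, by rw [Int.natAbs_sq, sq]⟩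
  rw [ha] at hk h
  rw [← pow_mul] at h
  have ha2 : 2 ≤ a := by
    by_contra! hlt
    interval_cases a <;> norm_num at hk
  rcases le_or_gt 14 z with hz | hz
  · exact sq_add_pow_ne_of_fourteen_le (by exact_mod_cast ha2) hz (by omega) h
  rcases le_or_gt a 200 with ha' | ha'
  · exact sq_add_pow_ne_of_le_of_le ha2 ha' (by omega) hy h
  · rcases hy with rfl | rfl
    · exact sq_add_cube_ne (by exact_mod_cast ha') h
    · exact sq_add_pow_five_ne (by exact_mod_cast ha') h
end

section
/- Let k be an integer with k > 1. If (x, y, z) is a solution in positive integers of the equation x² + (2k−1)^y = k^z with y ∈ {3, 5}, then z is odd. -/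
/-- A test by Euler's criterion modulo a few small primes: when it returns `true`,
`b - a` is not a perfect square. -/
def nonsquareDiff (a b : ℕ) : Bool :=
  [3, 5, 7, 11, 13, 17, 19, 23, 29, 31, 37, 41, 43, 47, 53, 59, 61, 67, 71, 73, 79].any
    fun p => ((b + (p - 1) * a) % p) ^ ((p - 1) / 2) % p == p - 1

lemma euler_pow_ne {p : ℕ} (hp : p.Prime) (h2 : 2 < p) {a b x : ℕ} (h : x ^ 2 + a = b) :
    ((b + (p - 1) * a) % p) ^ ((p - 1) / 2) % p ≠ p - 1 := by
  have := Fact.mk hp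
  intro hcon
  have hodd : p % 2 = 1 := hp.eq_two_or_odd.resolve_left (by omega)
  have hz : ((((b + (p - 1) * a) % p) ^ ((p - 1) / 2) % p : ℕ) : ZMod p) = ((p - 1 : ℕ) : ZMod p) :=
    congrArg _ hcon
  have hb : (b : ZMod p) = (x : ZMod p) ^ 2 + a := by rw [← h]; push_cast; ring
  rw [ZMod.natCast_mod, Nat.cast_pow, ZMod.natCast_mod, Nat.cast_add, Nat.cast_mul,
    Nat.cast_sub hp.one_le, hb, ZMod.natCast_self] at hz
  have hsq : (x : ZMod p) ^ 2 + a + (0 - (1 : ℕ)) * a = (x : ZMod p) ^ 2 := by push_cast; ring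
  rw [hsq, ← pow_mul, show 2 * ((p - 1) / 2) = p - 1 by omega] at hz
  by_cases hx : (x : ZMod p) = 0
  · rw [hx, zero_pow (by omega)] at hz
    simp at hz
  · rw [ZMod.pow_card_sub_one_eq_one hx] at hz
    have h3 : ((2 : ℕ) : ZMod p) = 0 := by
      have : (1 : ZMod p) + 1 = 0 := by linear_combination hz
      push_cast; linear_combination this
    rw [ZMod.natCast_eq_zero_iff] at h3
    exact absurd (Nat.le_of_dvd two_pos h3) (by omega)

lemma sq_add_ne_of_nonsquareDiff {a b : ℕ} (hab : nonsquareDiff a b = true) (x : ℕ) :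
    x ^ 2 + a ≠ b := by
  intro h
  simp only [nonsquareDiff, List.any_eq_true, beq_iff_eq] at hab
  obtain ⟨p, hp, hpe⟩ := hab
  have hp' : p.Prime ∧ 2 < p := by
    revert p
    simp only [List.mem_cons, List.not_mem_nil, or_false]
    rintro p (rfl | rfl | rfl | rfl | rfl | rfl | rfl | rfl | rfl | rfl | rfl | rfl | rfl | rfl |
      rfl | rfl | rfl | rfl | rfl | rfl | rfl) - <;> norm_num
  exact euler_pow_ne hp'.1 hp'.2 h hpe

lemma nonsquareDiff_of_small : ∀ k < 50, 1 < k → ∀ m < 9, 0 < m →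
    nonsquareDiff ((2 * k - 1) ^ 3) (k ^ (2 * m)) = true ∧
    nonsquareDiff ((2 * k - 1) ^ 5) (k ^ (2 * m)) = true := by
  decide +kernel

lemma nonsquareDiff_quintic_sextic : ∀ k < 320, 1 < k →
    nonsquareDiff ((2 * k - 1) ^ 5) (k ^ 6) = true := by
  decide +kernel

/-- A cubic with exactly one sign change has at most one positive root, so it has no positive
integral root if it changes sign strictly between two consecutive integers. -/
lemma cubic_no_root_of_sign_change {A B C E K k : ℕ} (hk : 0 < k)
    (h1 : A * K ^ 3 < B * K ^ 2 + C * K + E)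
    (h2 : B * (K + 1) ^ 2 + C * (K + 1) + E < A * (K + 1) ^ 3) :
    A * k ^ 3 ≠ B * k ^ 2 + C * k + E := by
  have key : ∀ u v : ℕ, u ≤ v →
      (B * v ^ 2 + C * v + E) * u ^ 3 ≤ (B * u ^ 2 + C * u + E) * v ^ 3 := fun u v huv => by
    have e2 : v ^ 2 * u ^ 2 * u ≤ v ^ 2 * u ^ 2 * v := Nat.mul_le_mul_left _ huv
    have e1 : v * u * u ^ 2 ≤ v * u * v ^ 2 := Nat.mul_le_mul_left _ (Nat.pow_le_pow_left huv 2)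
    have e0 : u ^ 3 ≤ v ^ 3 := Nat.pow_le_pow_left huv 3
    calc _ = B * (v ^ 2 * u ^ 2 * u) + C * (v * u * u ^ 2) + E * u ^ 3 := by ring
      _ ≤ B * (v ^ 2 * u ^ 2 * v) + C * (v * u * v ^ 2) + E * v ^ 3 := by gcongr
      _ = _ := by ring
  intro h
  have hk3 : 0 < k ^ 3 := by positivity
  rcases le_or_gt k K with hle | hgt
  · have := key k K hle
    rw [← h] at this
    have := Nat.mul_lt_mul_of_pos_right h1 hk3
    linarith
  · have := key (K + 1) k hgt
    rw [← h] at this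
    have := Nat.mul_lt_mul_of_pos_right h2 hk3
    linarith

lemma exists_sign_change : ∀ d < 200, 0 < d → ∃ j < 10,
    2 * d * (27020 / d + 16 + j) ^ 3 < (32 * d + 54040) * (27020 / d + 16 + j) ^ 2 +
      (176 * d + 254858) * (27020 / d + 16 + j) + (d ^ 2 + 2896 * d + 2096703) ∧
    (32 * d + 54040) * (27020 / d + 16 + j + 1) ^ 2 +
      (176 * d + 254858) * (27020 / d + 16 + j + 1) + (d ^ 2 + 2896 * d + 2096703) <
      2 * d * (27020 / d + 16 + j + 1) ^ 3 := by
  decide +kernel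

lemma sq_not_between {P x : ℤ} (hP : 0 ≤ P) (hx : 0 ≤ x) (h1 : P ^ 2 < x ^ 2)
    (h2 : x ^ 2 < (P + 1) ^ 2) : False := by
  have h3 := lt_of_pow_lt_pow_left₀ 2 hx h1
  have h4 := lt_of_pow_lt_pow_left₀ 2 (by omega) h2
  omega

lemma two_mul_le_of_sq_add_eq {x D K : ℤ} (hx : 0 ≤ x) (hK : 0 ≤ K) (hD : 0 < D)
    (h : x ^ 2 + D = K ^ 2) : 2 * K ≤ D + 1 := by
  have : x < K := lt_of_pow_lt_pow_left₀ 2 hK (by omega)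
  nlinarith

lemma cubic_ne {k x : ℤ} (hk : 50 ≤ k) (hx : 0 ≤ x) {m : ℕ}
    (h : x ^ 2 + (2 * k - 1) ^ 3 = (k ^ m) ^ 2) : False := by
  have hk2 : 50 * k ≤ k ^ 2 := by nlinarith
  have hk3 : 50 * k ^ 2 ≤ k ^ 3 := by nlinarith
  rcases lt_or_ge m 4 with hm | hm
  · interval_cases m
    · nlinarith
    · nlinarith
    · exact sq_not_between (P := k ^ 2 - 4 * k - 3) (by nlinarith) hx (by nlinarith) (by nlinarith)
    · exact sq_not_between (P := k ^ 3 - 4) (by nlinarith) hx (by nlinarith) (by nlinarith)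
  · have h1 := two_mul_le_of_sq_add_eq hx (by positivity) (pow_pos (by omega) 3) h
    have h2 : k ^ 4 ≤ k ^ m := pow_le_pow_right₀ (by omega) hm
    nlinarith

lemma sextic_ne {k x : ℤ} (hk : 320 ≤ k) (hx : 0 ≤ x)
    (h : x ^ 2 + (2 * k - 1) ^ 5 = (k ^ 3) ^ 2) : False := by
  have hk2 : 320 * k ≤ k ^ 2 := by nlinarith
  have hk3 : 320 * k ^ 2 ≤ k ^ 3 := by nlinarith
  obtain ⟨d, hd⟩ : ∃ d, d = k ^ 3 - 16 * k ^ 2 - 88 * k - 1448 - x := ⟨_, rfl⟩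
  have hP : 0 < k ^ 3 - 16 * k ^ 2 - 88 * k - 1448 := by linarith
  have hd0 : 0 < d := by
    have : x < k ^ 3 - 16 * k ^ 2 - 88 * k - 1448 :=
      lt_of_pow_lt_pow_left₀ 2 hP.le (by linarith)
    omega
  have hR : d * (k ^ 3 - 16 * k ^ 2 - 88 * k - 1448 + x) =
      54040 * k ^ 2 + 254858 * k + 2096703 := by
    rw [hd]; linear_combination -h
  have hd200 : d < 200 := by
    by_contra! hge
    have : 200 * (k ^ 3 - 16 * k ^ 2 - 88 * k - 1448) ≤
        d * (k ^ 3 - 16 * k ^ 2 - 88 * k - 1448 + x) :=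
      mul_le_mul hge (by omega) hP.le (by omega)
    linarith
  have hcubic : 2 * d * k ^ 3 = (32 * d + 54040) * k ^ 2 + (176 * d + 254858) * k +
      (d ^ 2 + 2896 * d + 2096703) := by
    rw [show x = k ^ 3 - 16 * k ^ 2 - 88 * k - 1448 - d by omega] at hR
    linear_combination hR
  lift d to ℕ using hd0.le
  lift k to ℕ using by omega
  obtain ⟨j, -, h1, h2⟩ := exists_sign_change d (by omega) (by omega)
  exact cubic_no_root_of_sign_change (k := k) (by omega) h1 h2 (by exact_mod_cast hcubic)

lemma quintic_ne {k x : ℤ} (hk : 50 ≤ k) (hx : 0 ≤ x) {m : ℕ} (h6 : m = 3 → 320 ≤ k)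
    (h : x ^ 2 + (2 * k - 1) ^ 5 = (k ^ m) ^ 2) : False := by
  have hk2 : 50 * k ≤ k ^ 2 := by nlinarith
  have hk3 : 50 * k ^ 2 ≤ k ^ 3 := by nlinarith
  have hk4 : 50 * k ^ 3 ≤ k ^ 4 := by nlinarith
  have hk5 : 50 * k ^ 4 ≤ k ^ 5 := by nlinarith
  rcases lt_or_ge m 6 with hm | hm
  · interval_cases m
    · nlinarith
    · nlinarith
    · nlinarith
    · exact sextic_ne (h6 rfl) hx h
    · exact sq_not_between (P := k ^ 4 - 16 * k + 39) (by linarith) hx (by linarith) (by linarith)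
    · exact sq_not_between (P := k ^ 5 - 16) (by linarith) hx (by linarith) (by linarith)
  · have h1 := two_mul_le_of_sq_add_eq hx (by positivity) (pow_pos (by omega) 5) h
    have h2 : k ^ 6 ≤ k ^ m := pow_le_pow_right₀ (by omega) hm
    have hk6 : 50 * k ^ 5 ≤ k ^ 6 := by nlinarith
    linarith

lemma exponent_lt_nine {k x : ℤ} (hk : 1 < k) (hx : 0 ≤ x) {m y : ℕ} (hy : y ≤ 5)
    (h : x ^ 2 + (2 * k - 1) ^ y = (k ^ m) ^ 2) : m < 9 := by
  by_contra! hm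
  have h1 := two_mul_le_of_sq_add_eq hx (by positivity) (pow_pos (by omega) y) h
  have h2 : k ^ 9 ≤ k ^ m := pow_le_pow_right₀ hk.le hm
  have h3 : (2 * k - 1) ^ y ≤ (2 * k - 1) ^ 5 := pow_le_pow_right₀ (by omega) hy
  have h4 : (2 * k - 1) ^ 4 ≤ (2 * k) ^ 4 := pow_le_pow_left₀ (by omega) (by omega) 4
  have h5 : (2 : ℤ) ^ 4 ≤ k ^ 4 := pow_le_pow_left₀ (by norm_num) (by omega) 4
  have h6 : (2 * k - 1) ^ 5 ≤ (2 * k - 1) * (2 * k) ^ 4 := by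
    rw [pow_succ' _ 4]
    exact mul_le_mul_of_nonneg_left h4 (by omega)
  have h7 : 2 ^ 4 * k ^ 5 ≤ k ^ 4 * k ^ 5 := mul_le_mul_of_nonneg_right h5 (by positivity)
  linarith

theorem stmt_2 (k : ℤ) (hk : 1 < k)
    (x y z : ℕ) (hx : 0 < x) (hy : 0 < y) (hz : 0 < z)
    (hy35 : y = 3 ∨ y = 5)
    (heq : (x : ℤ) ^ 2 + (2 * k - 1) ^ y = k ^ z) :
    Odd z := by
  by_contra hodd
  obtain ⟨m, rfl⟩ := (Nat.not_odd_iff_even.mp hodd).two_dvd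
  lift k to ℕ using by omega
  have hk1 : 1 < k := by exact_mod_cast hk
  have hnat : x ^ 2 + (2 * k - 1) ^ y = k ^ (2 * m) := by
    zify [show 1 ≤ 2 * k by omega]
    exact heq
  have hx0 : (0 : ℤ) ≤ x := by positivity
  rw [mul_comm 2 m, pow_mul] at heq
  have hm := exponent_lt_nine hk hx0 (by omega) heq
  rcases lt_or_ge k 50 with hk50 | hk50
  · have hs := nonsquareDiff_of_small k hk50 hk1 m hm (by omega)
    rcases hy35 with rfl | rfl
    · exact sq_add_ne_of_nonsquareDiff hs.1 x hnat
    · exact sq_add_ne_of_nonsquareDiff hs.2 x hnat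
  · have hk50' : (50 : ℤ) ≤ k := by exact_mod_cast hk50
    rcases hy35 with rfl | rfl
    · exact cubic_ne hk50' hx0 heq
    · refine quintic_ne hk50' hx0 (fun hm3 => ?_) heq
      subst hm3
      by_contra! hlt
      exact sq_add_ne_of_nonsquareDiff
        (nonsquareDiff_quintic_sextic k (by exact_mod_cast hlt) hk1) x hnat
end

section
/- Let k be an integer with k > 1 such that k is not a perfect square. If (x, y, z) is a solution in positive integers of x² + (2k−1)^y = k^z with y ∈ {3, 5}, then z is odd and there exist positive integers X₁, Y₁, Z₁, t, a sign λ ∈ {1, −1}, and integers u, v with u² − k v² = 1, such that: X₁² − k Y₁² = (−(2k−1))^{Z₁}, gcd(X₁, Y₁) = 1, y = Z₁ t, x + k^{(z−1)/2} √k = (X₁ + λ Y₁ √k)^t (u + v √k) (as elements of ℤ[√k]), and 1 < |(X₁ + Y₁ √k)/(X₁ − Y₁ √k)| < u₁ + v₁ √k, where (u₁, v₁) is the least positive solution of the Pell equation u² − k v² = 1. -/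
/-- An even exponent `2 * m` makes `k ^ (2 * m) - x ^ 2` factor into coprime factors, so that an
odd `y` splits the equation into two perfect powers. -/
theorem exists_pow_add_pow_eq {k x : ℤ} {y m : ℕ} (hk : 1 < k) (hx : 0 < x) (hy : Odd y)
    (h : x ^ 2 + (2 * k - 1) ^ y = k ^ (2 * m)) :
    ∃ a b : ℤ, 0 < a ∧ a < b ∧ a * b = 2 * k - 1 ∧ a ^ y + b ^ y = 2 * k ^ m := by
  have hprod : (k ^ m - x) * (k ^ m + x) = (2 * k - 1) ^ y := by
    rw [pow_mul'] at h
    linear_combination -h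
  have hk2 : IsCoprime (2 * k - 1) (2 * k) := ⟨-1, 1, by ring⟩
  have hcop : IsCoprime ((k ^ m - x) * (k ^ m + x)) (2 * k ^ m) := by
    rw [hprod]
    exact (hk2.of_mul_right_left.mul_right hk2.of_mul_right_right.pow_right).pow_left
  have hPQ : IsCoprime (k ^ m - x) (k ^ m + x) := by
    have := hcop.of_mul_left_left
    rw [show 2 * k ^ m = (k ^ m + x) + (k ^ m - x) * 1 by ring] at this
    exact IsCoprime.of_add_mul_left_right this
  obtain ⟨⟨a, ha⟩, b, hb⟩ := Int.eq_pow_of_mul_eq_pow_odd hPQ hy hprod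
  have hmono : StrictMono fun c : ℤ => c ^ y := hy.strictMono_pow
  have hkm : 0 < k ^ m := by positivity
  have hpos : 0 < (2 * k - 1) ^ y := pow_pos (by linarith) y
  have hbpos : 0 < k ^ m + x := by linarith
  have hapos : 0 < k ^ m - x := pos_of_mul_pos_left (hprod ▸ hpos) hbpos.le
  refine ⟨a, b, hy.pow_pos_iff.1 (ha ▸ hapos), ?_, ?_, ?_⟩
  · apply hmono.lt_iff_lt.1
    simp only [← ha, ← hb]
    linarith
  · apply hmono.injective
    simp only [mul_pow, ← ha, ← hb, hprod]
  · rw [← ha, ← hb]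
    ring

theorem one_add_cube_ne {k : ℤ} (hk : 1 < k) (m : ℕ) : 1 + (2 * k - 1) ^ 3 ≠ 2 * k ^ m := by
  intro h
  obtain _ | j := m
  · have := one_lt_pow₀ (show 1 < 2 * k - 1 by linarith) three_ne_zero
    linarith
  have hq : 4 * k ^ 2 - 6 * k + 3 = k ^ j :=
    mul_left_cancel₀ (show 2 * k ≠ 0 by positivity) (by linear_combination h)
  obtain _ | i := j
  · nlinarith
  have hd : k ∣ 3 := ⟨k ^ i - 4 * k + 6, by linear_combination hq⟩
  have hk3 : k = 3 := by
    have := Int.le_of_dvd (by norm_num) hd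
    interval_cases k <;> first | rfl | (norm_num at hd)
  subst hk3
  obtain _ | i := i
  · norm_num at hq
  · have : (9 : ℤ) ∣ 21 := ⟨3 ^ i, by linear_combination hq⟩
    norm_num at this

theorem one_add_pow_five_ne {k : ℤ} (hk : 1 < k) (m : ℕ) : 1 + (2 * k - 1) ^ 5 ≠ 2 * k ^ m := by
  intro h
  obtain _ | j := m
  · have := one_lt_pow₀ (show 1 < 2 * k - 1 by linarith) (show 5 ≠ 0 by norm_num)
    linarith
  have hq : 16 * k ^ 4 - 40 * k ^ 3 + 40 * k ^ 2 - 20 * k + 5 = k ^ j :=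
    mul_left_cancel₀ (show 2 * k ≠ 0 by positivity) (by linear_combination h)
  obtain _ | i := j
  · have h1 : (k - 1) * (16 * k ^ 3 - 24 * k ^ 2 + 16 * k - 4) = 0 := by linear_combination hq
    have h2 : 0 < 16 * k ^ 3 - 24 * k ^ 2 + 16 * k - 4 := by
      nlinarith [mul_pos (sq_pos_of_pos (zero_lt_one.trans hk)) (sub_pos.2 hk)]
    exact (mul_pos (sub_pos.2 hk) h2).ne' h1
  have hd : k ∣ 5 := ⟨k ^ i - 16 * k ^ 3 + 40 * k ^ 2 - 40 * k + 20, by linear_combination hq⟩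
  have hk5 : k = 5 := by
    have := Int.le_of_dvd (by norm_num) hd
    interval_cases k <;> first | rfl | (norm_num at hd)
  subst hk5
  obtain _ | i := i
  · norm_num at hq
  · have : (25 : ℤ) ∣ 5905 := ⟨5 ^ i, by linear_combination hq⟩
    norm_num at this

theorem cube_add_cube_ne_small : ∀ a < 15, ∀ b < 15, 0 < a →
    2 * ((2 * a + 1) ^ 3 + (2 * b + 1) ^ 3) ≠ ((2 * a + 1) * (2 * b + 1) + 1) ^ 2 := by
  decide +kernel

theorem pow_five_add_pow_five_ne_small : ∀ a < 65, ∀ b < 263, 0 < a →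
    4 * ((2 * a + 1) ^ 5 + (2 * b + 1) ^ 5) ≠ ((2 * a + 1) * (2 * b + 1) + 1) ^ 3 := by
  decide +kernel

theorem pow_five_add_pow_five_ne_small' : ∀ a < 50, ∀ b < 50, 0 < a →
    8 * ((2 * a + 1) ^ 5 + (2 * b + 1) ^ 5) ≠ ((2 * a + 1) * (2 * b + 1) + 1) ^ 4 := by
  decide +kernel

theorem lt_of_sq_add_cube_eq {k x : ℤ} (hx : 0 < x) (h : x ^ 2 + (2 * k - 1) ^ 3 = k ^ 4) :
    k < 16 := by
  by_contra! h1
  obtain ⟨c, rfl⟩ : ∃ c, k = c + 16 := ⟨k - 16, by ring⟩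
  have hc : 0 ≤ c := by linarith
  have h2 : x < (c + 16) ^ 2 - 4 * (c + 16) - 2 := by
    apply lt_of_pow_lt_pow_left₀ 2 (by nlinarith)
    linarith
  have h3 : (c + 16) ^ 2 - 4 * (c + 16) - 3 < x := by
    apply lt_of_pow_lt_pow_left₀ 2 hx.le
    nlinarith [sq_nonneg c]
  linarith

theorem lt_of_sq_add_pow_five_eq_pow_six {k x : ℤ} (hx : 0 < x)
    (h : x ^ 2 + (2 * k - 1) ^ 5 = k ^ 6) : k < 27100 := by
  by_contra! h1
  obtain ⟨c, rfl⟩ : ∃ c, k = c + 27100 := ⟨k - 27100, by ring⟩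
  have hc : 0 ≤ c := by linarith
  set P := (c + 27100) ^ 3 - 16 * (c + 27100) ^ 2 - 88 * (c + 27100) - 1448 with hP
  have hP0 : 0 ≤ P := by
    rw [hP]
    nlinarith [pow_nonneg hc 3, pow_nonneg hc 2]
  have h2 : x < P := by
    apply lt_of_pow_lt_pow_left₀ 2 hP0
    rw [hP]
    nlinarith [pow_nonneg hc 3, pow_nonneg hc 2]
  have h3 : P - 1 < x := by
    apply lt_of_pow_lt_pow_left₀ 2 hx.le
    rw [hP]
    nlinarith [pow_nonneg hc 3, pow_nonneg hc 2]
  linarith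

theorem lt_of_sq_add_pow_five_eq_pow_eight {k x : ℤ} (hx : 0 < x)
    (h : x ^ 2 + (2 * k - 1) ^ 5 = k ^ 8) : k < 46 := by
  by_contra! h1
  obtain ⟨c, rfl⟩ : ∃ c, k = c + 46 := ⟨k - 46, by ring⟩
  have hc : 0 ≤ c := by linarith
  set P := (c + 46) ^ 4 - 16 * (c + 46) + 40 with hP
  have hP0 : 0 ≤ P := by
    rw [hP]
    nlinarith [pow_nonneg hc 4, pow_nonneg hc 3, pow_nonneg hc 2]
  have h2 : x < P := by
    apply lt_of_pow_lt_pow_left₀ 2 hP0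
    rw [hP]
    nlinarith [pow_nonneg hc 3, pow_nonneg hc 2]
  have h3 : P - 1 < x := by
    apply lt_of_pow_lt_pow_left₀ 2 hx.le
    rw [hP]
    nlinarith [pow_nonneg hc 4, pow_nonneg hc 3, pow_nonneg hc 2]
  linarith

theorem exists_eq_two_mul_add_one_of_mul_eq {a b k : ℤ} (ha : 0 < a) (hb : 0 < b)
    (h : a * b = 2 * k - 1) :
    ∃ A B : ℕ, a = 2 * A + 1 ∧ b = 2 * B + 1 := by
  have ho : Odd (a * b) := by rw [h]; exact ⟨k - 1, by ring⟩
  obtain ⟨⟨c, rfl⟩, d, rfl⟩ := Int.odd_mul.1 ho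
  lift c to ℕ using by linarith
  lift d to ℕ using by linarith
  exact ⟨c, d, rfl, rfl⟩

theorem odd_exponent_of_sq_add_pow_eq {k : ℤ} (hk : 1 < k) {x : ℤ} (hx : 0 < x) {y z : ℕ}
    (hy : y = 3 ∨ y = 5) (h : x ^ 2 + (2 * k - 1) ^ y = k ^ z) : Odd z := by
  by_contra hz
  obtain ⟨m, rfl⟩ := even_iff_exists_two_mul.1 (Nat.not_odd_iff_even.1 hz)
  have hyo : Odd y := by rcases hy with rfl | rfl <;> decide
  obtain ⟨a, b, ha, hab, hmul, hadd⟩ := exists_pow_add_pow_eq hk hx hyo h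
  have ha1 : a ≠ 1 := by
    rintro rfl
    rw [one_mul] at hmul
    rw [one_pow, hmul] at hadd
    rcases hy with rfl | rfl
    · exact one_add_cube_ne hk m hadd
    · exact one_add_pow_five_ne hk m hadd
  obtain ⟨A, B, rfl, rfl⟩ := exists_eq_two_mul_add_one_of_mul_eq ha (ha.trans hab) hmul
  have hA : 0 < A := by omega
  have hAB : A < B := by omega
  have hbk : (2 * B + 1 : ℤ) < k := by nlinarith
  have hapow : (2 * A + 1 : ℤ) ^ y < (2 * B + 1) ^ y := pow_lt_pow_left₀ hab ha.le hyo.pos.ne'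
  have hapos : (0 : ℤ) < (2 * A + 1) ^ y := pow_pos ha y
  have hmy : m < y := by
    have := pow_lt_pow_left₀ hbk (ha.trans hab).le hyo.pos.ne'
    exact (pow_lt_pow_iff_right₀ hk).1 (by linarith)
  have hym : y < 2 * m := by
    have := pow_le_pow_left₀ (by linarith) (show k ≤ 2 * k - 1 by linarith) y
    exact (pow_lt_pow_iff_right₀ hk).1 (by nlinarith)
  rcases hy with rfl | rfl
  · obtain rfl : m = 2 := by omega
    have := lt_of_sq_add_cube_eq hx h
    refine cube_add_cube_ne_small A (by omega) B (by omega) hA ?_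
    zify
    rw [hmul, hadd]
    ring
  obtain rfl | rfl : m = 3 ∨ m = 4 := by omega
  · have hk' := lt_of_sq_add_pow_five_eq_pow_six hx h
    have hb : (2 * B + 1 : ℤ) < 526 := by
      have := pow_lt_pow_left₀ hk' (by linarith) three_ne_zero
      refine lt_of_pow_lt_pow_left₀ 5 (by norm_num) ?_
      linarith
    have ha' : (2 * A + 1 : ℤ) < 131 := by
      have h8 : ((2 * A + 1) * (2 * B + 1) : ℤ) ^ 3 ≤ (2 * k) ^ 3 :=
        pow_le_pow_left₀ (mul_pos ha (ha.trans hab)).le (by linarith) 3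
      have hlt : (2 * A + 1 : ℤ) ^ 3 < 8 * (2 * B + 1) ^ 2 := by
        refine lt_of_mul_lt_mul_left ?_ (pow_pos (ha.trans hab) 3).le
        linarith
      have hB2 := pow_le_pow_left₀ (ha.trans hab).le (show (2 * B + 1 : ℤ) ≤ 525 by linarith) 2
      refine lt_of_pow_lt_pow_left₀ 3 (by norm_num) ?_
      linarith
    refine pow_five_add_pow_five_ne_small A (by omega) B (by omega) hA ?_
    zify
    rw [hmul, hadd]
    ring
  · have := lt_of_sq_add_pow_five_eq_pow_eight hx h
    refine pow_five_add_pow_five_ne_small' A (by omega) B (by omega) hA ?_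
    zify
    rw [hmul, hadd]
    ring

/-- The embedding of the Pell group into the reals. -/
noncomputable def pellToReal {k : ℤ} (hk : 0 ≤ k) : Pell.Solution₁ k →* ℝ where
  toFun g := g.x + g.y * √k
  map_one' := by simp
  map_mul' g h := by
    have hs : √(k : ℝ) ^ 2 = k := Real.sq_sqrt (by exact_mod_cast hk)
    simp only [Pell.Solution₁.x_mul, Pell.Solution₁.y_mul]
    push_cast
    linear_combination -(g.y * h.y : ℝ) * hs

theorem pellToReal_mul_conj {k : ℤ} (hk : 0 ≤ k) (g : Pell.Solution₁ k) :
    pellToReal hk g * (g.x - g.y * √k) = 1 := by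
  have hs : √(k : ℝ) ^ 2 = k := Real.sq_sqrt (by exact_mod_cast hk)
  have hg : (g.x ^ 2 - k * g.y ^ 2 : ℝ) = 1 := by exact_mod_cast g.prop
  change (g.x + g.y * √k : ℝ) * _ = 1
  linear_combination hg - (g.y ^ 2 : ℝ) * hs

theorem pellToReal_inv {k : ℤ} (hk : 0 ≤ k) (g : Pell.Solution₁ k) :
    pellToReal hk g⁻¹ = (pellToReal hk g)⁻¹ := by
  apply eq_inv_of_mul_eq_one_left
  rw [← map_mul, inv_mul_cancel, map_one]

/-- Multiplying `x + c√k` by a unit of norm one brings the absolute ratio of its conjugates into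
the interval `[ε⁻¹, ε)`, where `ε` is the real value of a given Pell solution. -/
theorem exists_unit_mul_ratio_mem_Ico {k : ℤ} (hk : 0 ≤ k) {a : Pell.Solution₁ k}
    (ha : 1 < pellToReal hk a) {x c N : ℤ} (hN : N ≠ 0) (hxc : IsCoprime x c)
    (h : x ^ 2 - k * c ^ 2 = N) :
    ∃ X Y u v : ℤ, u ^ 2 - k * v ^ 2 = 1 ∧ X ^ 2 - k * Y ^ 2 = N ∧ IsCoprime X Y ∧
      (x + c * √k : ℝ) = (X + Y * √k) * (u + v * √k) ∧
      |(X + Y * √k : ℝ) / (X - Y * √k)| ∈ Set.Ico (pellToReal hk a)⁻¹ (pellToReal hk a) := by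
  have hs : √(k : ℝ) ^ 2 = k := Real.sq_sqrt (by exact_mod_cast hk)
  set ε := pellToReal hk a with hε
  have hε0 : 0 < ε := zero_lt_one.trans ha
  have hnorm : (x + c * √k : ℝ) * (x - c * √k) = N := by
    have : (x ^ 2 - k * c ^ 2 : ℝ) = N := by exact_mod_cast h
    linear_combination this - (c ^ 2 : ℝ) * hs
  have hN' : (N : ℝ) ≠ 0 := by exact_mod_cast hN
  have hα : (x + c * √k : ℝ) ≠ 0 := left_ne_zero_of_mul (hnorm ▸ hN')
  have hα' : (x - c * √k : ℝ) ≠ 0 := right_ne_zero_of_mul (hnorm ▸ hN')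
  have hr : 0 < |(x + c * √k : ℝ) / (x - c * √k)| := abs_pos.2 (div_ne_zero hα hα')
  obtain ⟨n, hn1, hn2⟩ := exists_mem_Ico_zpow (mul_pos hr hε0)
    (one_lt_pow₀ ha two_ne_zero : 1 < ε ^ 2)
  obtain ⟨g, hg⟩ : ∃ g, g = a ^ n := ⟨_, rfl⟩
  have hgε : pellToReal hk g = ε ^ n := by
    rw [hg, hε, map_zpow' _ (pellToReal_inv hk)]
  set w := ε ^ n with hw
  have hw0 : 0 < w := zpow_pos hε0 n
  have hwsq : (ε ^ 2) ^ n = w ^ 2 := by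
    rw [hw, ← zpow_natCast, ← zpow_natCast, ← zpow_mul, ← zpow_mul, mul_comm]
  rw [zpow_add_one₀ (by positivity)] at hn2
  rw [hwsq] at hn1 hn2
  have hgprop := g.prop
  have hconj := pellToReal_mul_conj hk g
  have hval : (g.x + g.y * √k : ℝ) = w := hgε
  rw [hgε] at hconj
  have hconj' : (g.x - g.y * √k : ℝ) = w⁻¹ := eq_inv_of_mul_eq_one_right hconj
  have hβ : ((x * g.x - k * c * g.y : ℤ) + (c * g.x - x * g.y : ℤ) * √k : ℝ) =
      (x + c * √k) * w⁻¹ := by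
    rw [← hconj']
    push_cast
    linear_combination (c * g.y : ℝ) * hs
  have hβ' : ((x * g.x - k * c * g.y : ℤ) - (c * g.x - x * g.y : ℤ) * √k : ℝ) =
      (x - c * √k) * w := by
    rw [← hval]
    push_cast
    linear_combination (c * g.y : ℝ) * hs
  refine ⟨x * g.x - k * c * g.y, c * g.x - x * g.y, g.x, g.y, hgprop, ?_, ?_, ?_, ?_⟩
  · linear_combination (x ^ 2 - k * c ^ 2) * hgprop + h
  · obtain ⟨p, q, hpq⟩ := hxc
    exact ⟨p * g.x + q * g.y, p * k * g.y + q * g.x,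
      by linear_combination (p * x + q * c) * hgprop + hpq⟩
  · rw [hβ, hval]
    field_simp
  · have hratio : (x + c * √k : ℝ) * w⁻¹ / ((x - c * √k) * w) =
        (x + c * √k) / (x - c * √k) / w ^ 2 := by
      field_simp
    rw [hβ, hβ', hratio, abs_div, abs_of_pos (pow_pos hw0 2)]
    have hw2 := pow_pos hw0 2
    constructor
    · rw [le_div_iff₀ hw2, inv_mul_le_iff₀ hε0]
      linarith
    · rw [div_lt_iff₀ hw2]
      nlinarith

theorem not_dvd_two_mul_of_norm_eq {k X Y : ℤ} (hk : 1 < k) (hXY : IsCoprime X Y) {y : ℕ}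
    (hy : y ≠ 0) (h : X ^ 2 - k * Y ^ 2 = -(2 * k - 1) ^ y) :
    ¬ (2 * k - 1) ^ y ∣ 2 * X * Y := by
  intro hd
  have hdvd : 2 * k - 1 ∣ 2 * X * Y := (dvd_pow_self _ hy).trans hd
  have h2 : IsCoprime (2 * k - 1) 2 := ⟨-1, k, by ring⟩
  have hdXY : 2 * k - 1 ∣ X * Y := h2.dvd_of_dvd_mul_left (by rwa [← mul_assoc])
  have hnorm : 2 * k - 1 ∣ X ^ 2 - k * Y ^ 2 := by
    rw [h]
    exact (dvd_pow_self _ hy).neg_right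
  have hX4 : 2 * k - 1 ∣ X ^ 4 := by
    have : X ^ 4 = X ^ 2 * (X ^ 2 - k * Y ^ 2) + k * (X * Y) * (X * Y) := by ring
    rw [this]
    exact dvd_add (hnorm.mul_left _) (hdXY.mul_left _)
  have hY4 : 2 * k - 1 ∣ Y ^ 4 := by
    have hk2 : IsCoprime (2 * k - 1) k := ⟨-1, 2, by ring⟩
    refine hk2.dvd_of_dvd_mul_left ?_
    have : k * Y ^ 4 = (X * Y) * (X * Y) - Y ^ 2 * (X ^ 2 - k * Y ^ 2) := by ring
    rw [this]
    exact dvd_sub (hdXY.mul_left _) (hnorm.mul_left _)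
  have := Int.isUnit_iff.1 (hXY.pow.isUnit_of_dvd' hX4 hY4)
  omega

theorem eq_of_add_mul_sqrt_eq {k : ℤ} (hk : 0 ≤ k) (hns : ¬ IsSquare k) {a b c d : ℤ}
    (h : (a + b * √k : ℝ) = c + d * √k) : b = d := by
  by_contra hne
  have hirr : Irrational √(k : ℝ) := irrational_sqrt_intCast_iff.2 ⟨hns, hk⟩
  refine (hirr.intCast_mul (sub_ne_zero.2 hne)) ⟨(c - a : ℤ), ?_⟩
  push_cast
  linear_combination -h

/-- The ratio of conjugates never lies on the boundary `ε`, since otherwise `2 * k - 1` would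
divide `2 * X * Y`. -/
theorem ratio_ne_pellToReal {k X Y : ℤ} (hk : 1 < k) (hns : ¬ IsSquare k) (hXY : IsCoprime X Y)
    {y : ℕ} (hy : y ≠ 0) (h : X ^ 2 - k * Y ^ 2 = -(2 * k - 1) ^ y) (hX : 0 < X) (hY : 0 < Y)
    (a : Pell.Solution₁ k) :
    |(X + Y * √k : ℝ) / (X - Y * √k)| ≠ pellToReal (zero_lt_one.trans hk).le a := by
  intro heq
  have hs : √(k : ℝ) ^ 2 = k := Real.sq_sqrt (by exact_mod_cast (zero_lt_one.trans hk).le)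
  have hM : (0 : ℝ) < (2 * k - 1) ^ y := by
    have : (1 : ℝ) < k := by exact_mod_cast hk
    exact pow_pos (by linarith) y
  have hnorm : (X + Y * √k : ℝ) * (X - Y * √k) = -(2 * k - 1) ^ y := by
    have : (X ^ 2 - k * Y ^ 2 : ℝ) = -(2 * k - 1) ^ y := by exact_mod_cast h
    linear_combination this - (Y ^ 2 : ℝ) * hs
  have hplus : (0 : ℝ) < X + Y * √k := by positivity
  have hminus : (X - Y * √k : ℝ) < 0 := by
    by_contra! hge
    nlinarith [mul_nonneg hplus.le hge]
  rw [abs_div, abs_of_pos hplus, abs_of_neg hminus, div_eq_iff (by linarith)] at heq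
  have hsq : ((X ^ 2 + k * Y ^ 2 : ℤ) + (2 * X * Y : ℤ) * √k : ℝ) =
      ((2 * k - 1) ^ y * a.x : ℤ) + ((2 * k - 1) ^ y * a.y : ℤ) * √k := by
    have hval : pellToReal (zero_lt_one.trans hk).le a = (a.x + a.y * √k : ℝ) := rfl
    rw [hval] at heq
    push_cast
    linear_combination (X + Y * √k : ℝ) * heq - (a.x + a.y * √k : ℝ) * hnorm - (Y ^ 2 : ℝ) * hs
  exact not_dvd_two_mul_of_norm_eq hk hXY hy h
    ⟨a.y, eq_of_add_mul_sqrt_eq (zero_lt_one.trans hk).le hns hsq⟩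

theorem Pell.IsFundamental.pellToReal_le {k : ℤ} (hk : 0 < k) {a : Pell.Solution₁ k}
    (ha : Pell.IsFundamental a) {u v : ℤ} (hu : 0 < u) (hv : 0 < v)
    (h : u ^ 2 - k * v ^ 2 = 1) : pellToReal hk.le a ≤ u + v * √k := by
  have hu1 : 1 < u := by nlinarith [mul_pos hk (pow_pos hv 2)]
  have hx : a.x ≤ u := by
    have hmin : 1 < (Pell.Solution₁.mk u v h).x → _ := ha.2.2
    exact hmin hu1
  have hy : a.y ≤ v := by
    refine le_of_pow_le_pow_left₀ two_ne_zero hv.le ?_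
    have hsq := pow_le_pow_left₀ (zero_lt_one.trans ha.1).le hx 2
    have := a.prop
    exact le_of_mul_le_mul_left (by linarith) hk
  change (a.x + a.y * √k : ℝ) ≤ _
  gcongr

theorem stmt_3 (k : ℤ) (hk : 1 < k) (hns : ¬ IsSquare k)
    (x y z : ℕ) (hx : 0 < x) (hy : 0 < y) (hz : 0 < z)
    (hy35 : y = 3 ∨ y = 5)
    (heq : (x : ℤ) ^ 2 + (2 * k - 1) ^ y = k ^ z) :
    Odd z ∧
    ∃ (X₁ Y₁ : ℤ) (Z₁ t : ℕ) (lam u v : ℤ),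
      0 < X₁ ∧ 0 < Y₁ ∧ 0 < Z₁ ∧ 0 < t ∧
      (lam = 1 ∨ lam = -1) ∧
      u ^ 2 - k * v ^ 2 = 1 ∧
      X₁ ^ 2 - k * Y₁ ^ 2 = (-(2 * k - 1)) ^ Z₁ ∧
      Int.gcd X₁ Y₁ = 1 ∧
      y = Z₁ * t ∧
      (x : ℝ) + (k : ℝ) ^ ((z - 1) / 2) * Real.sqrt k =
        ((X₁ : ℝ) + (lam : ℝ) * (Y₁ : ℝ) * Real.sqrt k) ^ t *
          ((u : ℝ) + (v : ℝ) * Real.sqrt k) ∧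
      ∀ u₁ v₁ : ℤ, (0 < u₁ ∧ 0 < v₁ ∧ u₁ ^ 2 - k * v₁ ^ 2 = 1 ∧
          ∀ u' v' : ℤ, 0 < u' → 0 < v' → u' ^ 2 - k * v' ^ 2 = 1 →
            (u₁ : ℝ) + (v₁ : ℝ) * Real.sqrt k ≤ (u' : ℝ) + (v' : ℝ) * Real.sqrt k) →
        1 < |((X₁ : ℝ) + (Y₁ : ℝ) * Real.sqrt k) / ((X₁ : ℝ) - (Y₁ : ℝ) * Real.sqrt k)| ∧
        |((X₁ : ℝ) + (Y₁ : ℝ) * Real.sqrt k) / ((X₁ : ℝ) - (Y₁ : ℝ) * Real.sqrt k)| <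
          (u₁ : ℝ) + (v₁ : ℝ) * Real.sqrt k := by
  have hk0 : 0 < k := zero_lt_one.trans hk
  have hx' : (0 : ℤ) < x := by exact_mod_cast hx
  have hzodd := odd_exponent_of_sq_add_pow_eq hk hx' hy35 heq
  refine ⟨hzodd, ?_⟩
  obtain ⟨n, rfl⟩ := hzodd
  have hyo : Odd y := by rcases hy35 with rfl | rfl <;> decide
  have hM : 0 < (2 * k - 1) ^ y := pow_pos (by linarith) y
  have hα : (x : ℤ) ^ 2 - k * (k ^ n) ^ 2 = -(2 * k - 1) ^ y := by
    linear_combination heq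
  have hxk : IsCoprime (x : ℤ) (k ^ n) := by
    have hkM : IsCoprime k ((2 * k - 1) ^ y) := IsCoprime.pow_right ⟨2, -1, by ring⟩
    have hkx : IsCoprime k ((x : ℤ) ^ 2) := by
      rw [show (x : ℤ) ^ 2 = -(2 * k - 1) ^ y + k * (k ^ n) ^ 2 by linear_combination hα]
      exact hkM.neg_right.add_mul_left_right _
    exact ((IsCoprime.pow_right_iff two_pos).1 hkx).symm.pow_right
  obtain ⟨a, ha⟩ := Pell.IsFundamental.exists_of_not_isSquare hk0 hns
  have ha1 : 1 < pellToReal hk0.le a := by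
    have h1 : (1 : ℝ) < a.x := by exact_mod_cast ha.1
    have h2 : (0 : ℝ) < a.y := by exact_mod_cast ha.2.1
    change (1 : ℝ) < a.x + a.y * √k
    have : 0 ≤ (a.y : ℝ) * √k := by positivity
    linarith
  obtain ⟨X, Y, u, v, huv, hN, hXY, hval, hlow, hupp⟩ :=
    exists_unit_mul_ratio_mem_Ico hk0.le ha1 (neg_ne_zero.2 hM.ne') hxk hα
  have hM1 : k < (2 * k - 1) ^ y :=
    (show k < 2 * k - 1 by linarith).trans_le (le_self_pow₀ (by linarith) hy.ne')
  have hX0 : X ≠ 0 := by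
    rintro rfl
    have hY1 : Y ^ 2 = 1 := Int.isUnit_sq (isCoprime_zero_left.1 hXY)
    rw [hY1] at hN
    linarith
  have hY0 : Y ≠ 0 := by
    rintro rfl
    nlinarith [sq_nonneg X]
  have hNabs : |X| ^ 2 - k * |Y| ^ 2 = -(2 * k - 1) ^ y := by rwa [sq_abs, sq_abs]
  have hXYabs : IsCoprime |X| |Y| := hXY.abs_abs
  have hX1 := abs_pos.2 hX0
  have hY1 := abs_pos.2 hY0
  obtain ⟨lam, hlam, σ, hσ, hXσ, hYσ⟩ : ∃ lam : ℤ, (lam = 1 ∨ lam = -1) ∧ ∃ σ : ℤ,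
      (σ = 1 ∨ σ = -1) ∧ X = σ * |X| ∧ Y = σ * lam * |Y| := by
    rcases abs_choice X with h1 | h1 <;> rcases abs_choice Y with h2 | h2 <;> rw [h1, h2]
    · exact ⟨1, .inl rfl, 1, .inl rfl, by ring, by ring⟩
    · exact ⟨-1, .inr rfl, 1, .inl rfl, by ring, by ring⟩
    · exact ⟨-1, .inr rfl, -1, .inr rfl, by ring, by ring⟩
    · exact ⟨1, .inl rfl, -1, .inr rfl, by ring, by ring⟩
  generalize |X| = X₁, |Y| = Y₁ at *
  have hσsq : σ ^ 2 = 1 := by rcases hσ with rfl | rfl <;> norm_num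
  have hσR : (σ : ℝ) ^ 2 = 1 := by exact_mod_cast hσsq
  have hσ0 : (σ : ℝ) ≠ 0 := by rintro h0; simp [h0] at hσR
  have hρ : ((X : ℝ) + Y * √k) / (X - Y * √k) =
      (X₁ + lam * Y₁ * √k) / (X₁ - lam * Y₁ * √k) := by
    rw [← mul_div_mul_left _ _ hσ0, hXσ, hYσ]
    push_cast
    ring_nf
    rw [hσR]
    ring
  have hne := ratio_ne_pellToReal hk hns hXYabs hyo.pos.ne' hNabs hX1 hY1 a
  refine ⟨X₁, Y₁, y, 1, lam, σ * u, σ * v, hX1, hY1, hy, one_pos, hlam, ?_, ?_,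
    Int.isCoprime_iff_gcd_eq_one.1 hXYabs, (mul_one y).symm, ?_, ?_⟩
  · linear_combination σ ^ 2 * huv + hσsq
  · rw [hNabs, hyo.neg_pow]
  · rw [show (2 * n + 1 - 1) / 2 = n by omega, pow_one]
    push_cast at hval ⊢
    rw [hval, hXσ, hYσ]
    push_cast
    ring
  · rintro u₁ v₁ ⟨hu₁, hv₁, huv₁, -⟩
    have hle := ha.pellToReal_le hk0 hu₁ hv₁ huv₁
    have hX1R : (0 : ℝ) < X₁ := by exact_mod_cast hX1
    have hY1R : (0 : ℝ) < Y₁ := by exact_mod_cast hY1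
    have hsR : (0 : ℝ) < √k := Real.sqrt_pos.2 (by exact_mod_cast hk0)
    have hYs := mul_pos hY1R hsR
    have hsq : √(k : ℝ) ^ 2 = k := Real.sq_sqrt (by exact_mod_cast hk0.le)
    have hminus : (X₁ - Y₁ * √k : ℝ) < 0 := by
      have hNR : (X₁ ^ 2 - k * Y₁ ^ 2 : ℝ) < 0 := by
        exact_mod_cast (by linarith : X₁ ^ 2 - k * Y₁ ^ 2 < 0)
      nlinarith
    have hone : 1 < |(X₁ + Y₁ * √k : ℝ) / (X₁ - Y₁ * √k)| := by
      rw [abs_div, abs_of_neg hminus, one_lt_div (by linarith)]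
      exact (by linarith : _ < X₁ + Y₁ * √(k : ℝ)).trans_le (le_abs_self _)
    refine ⟨hone, lt_of_lt_of_le ?_ hle⟩
    rw [hρ] at hlow hupp
    rcases hlam with rfl | rfl
    · simpa using hupp
    · refine lt_of_le_of_ne ?_ hne
      rw [← inv_le_inv₀ (zero_lt_one.trans ha1) (zero_lt_one.trans hone), ← abs_inv, inv_div]
      simpa [← sub_eq_add_neg] using hlow
end

section
/- The equation X² = Y⁶ − 8Y³ + 12Y² − 6Y + 1 has no solutions in positive integers X, Y. -/
theorem stmt_5 : ¬ ∃ (X Y : ℤ), 0 < X ∧ 0 < Y ∧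
    X ^ 2 = Y ^ 6 - 8 * Y ^ 3 + 12 * Y ^ 2 - 6 * Y + 1 := by
  rintro ⟨X, Y, hX, hY, h⟩
  rcases lt_or_ge Y 6 with hlt | hge
  · have hX_lt : X < 123 := by
      interval_cases Y <;> nlinarith
    interval_cases Y <;> interval_cases X <;> omega
  · have lower : Y ^ 3 - 4 < X := by
      apply lt_of_pow_lt_pow_left₀ 2 hX.le
      nlinarith
    have upper : X < Y ^ 3 - 3 := by
      have hcube : 0 ≤ Y ^ 3 - 3 := by nlinarith [pow_le_pow_left₀ (by norm_num) hge 3]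
      apply lt_of_pow_lt_pow_left₀ 2 hcube
      nlinarith [mul_nonneg (sq_nonneg Y) (sub_nonneg.mpr hge)]
    omega
end

section
/- The equation X² = Y⁶ − 32Y⁵ + 80Y⁴ − 80Y³ + 40Y² − 10Y + 1 has no solutions in positive integers X, Y. -/
/-- The residue modulo `p` of `Y ^ 6 - (2 * Y - 1) ^ 5` at `Y = n + 2`. -/
def sexticResidue (p n : ℕ) : ℕ := (Nat.pow (n + 2) 6 + (p - 1) * Nat.pow (2 * n + 3) 5) % p

lemma pow_mod_ne_of_sq_modEq {p x a : ℕ} (hp : p.Prime) (h2 : 2 < p) (h : x ^ 2 ≡ a [MOD p]) :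
    a ^ (p / 2) % p ≠ p - 1 := by
  have : Fact p.Prime := ⟨hp⟩
  have : Fact (2 < p) := ⟨h2⟩
  intro hm
  have hodd : 2 * (p / 2) = p - 1 := by
    have := hp.eq_two_or_odd
    lia
  have ha : (a : ZMod p) = (x : ZMod p) ^ 2 := by
    exact_mod_cast ((ZMod.natCast_eq_natCast_iff _ _ _).2 h).symm
  have hneg : (a : ZMod p) ^ (p / 2) = -1 := by
    have hc := congrArg (Nat.cast (R := ZMod p)) hm
    rw [ZMod.natCast_mod, Nat.cast_pow, Nat.cast_sub hp.one_le] at hc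
    simpa using hc
  rw [ha, ← pow_mul, hodd] at hneg
  by_cases hx : (x : ZMod p) = 0
  · rw [hx, zero_pow (by lia)] at hneg
    exact one_ne_zero (neg_eq_zero.1 hneg.symm)
  · rw [ZMod.pow_card_sub_one_eq_one hx] at hneg
    exact ZMod.neg_one_ne_one hneg.symm

lemma sq_modEq_sexticResidue {p n x : ℕ} (hp : 0 < p)
    (h : x ^ 2 + (2 * n + 3) ^ 5 = (n + 2) ^ 6) : x ^ 2 ≡ sexticResidue p n [MOD p] := by
  have key : (n + 2) ^ 6 + (p - 1) * (2 * n + 3) ^ 5 = x ^ 2 + p * (2 * n + 3) ^ 5 := by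
    obtain ⟨m, rfl⟩ : ∃ m, p = m + 1 := ⟨p - 1, by lia⟩
    rw [← h, Nat.add_sub_cancel]
    ring
  rw [sexticResidue, Nat.pow_eq, Nat.pow_eq, key]
  simp [Nat.ModEq]

/-- Some prime from a fixed list has `sexticResidue p n` as a quadratic nonresidue. -/
def hasNonresidue (n : ℕ) : Bool :=
  [79, 31, 293, 353, 359, 281, 101, 383, 173, 211].any fun p =>
    Nat.beq (Nat.pow (sexticResidue p n) (p / 2) % p) (p - 1)

/-- Test a Boolean predicate on all natural numbers below a bound. -/
def allBelow (f : ℕ → Bool) : ℕ → Bool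
  | 0 => true
  | n + 1 => f n && allBelow f n

lemma apply_of_allBelow {f : ℕ → Bool} {n : ℕ} (h : allBelow f n = true) {m : ℕ} (hm : m < n) :
    f m = true := by
  induction n with
  | zero => lia
  | succ n ih =>
    rw [allBelow, Bool.and_eq_true] at h
    obtain rfl | hlt := Nat.lt_succ_iff_lt_or_eq.1 hm |>.symm
    · exact h.1
    · exact ih h.2 hlt

lemma allBelow_hasNonresidue :
    allBelow (fun q => allBelow (fun r => hasNonresidue (165 * q + r)) 165) 165 = true := by
  decide +kernel

lemma not_sextic_of_lt {n x : ℕ} (hn : n < 27225) : x ^ 2 + (2 * n + 3) ^ 5 ≠ (n + 2) ^ 6 := by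
  intro h
  have hn' := apply_of_allBelow (apply_of_allBelow allBelow_hasNonresidue (m := n / 165) (by lia))
    (Nat.mod_lt n (by norm_num))
  rw [Nat.div_add_mod, hasNonresidue, List.any_eq_true] at hn'
  obtain ⟨p, hp, hr⟩ := hn'
  have hpp : p.Prime ∧ 2 < p := by
    simp only [List.mem_cons, List.not_mem_nil, or_false] at hp
    rcases hp with rfl | rfl | rfl | rfl | rfl | rfl | rfl | rfl | rfl | rfl <;> norm_num
  exact pow_mod_ne_of_sq_modEq hpp.1 hpp.2 (sq_modEq_sexticResidue hpp.1.pos h)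
    (Nat.eq_of_beq_eq_true hr)

lemma not_sextic_of_le {X Y : ℤ} (hX : 0 < X) (hY : 27041 ≤ Y) :
    X ^ 2 ≠ Y ^ 6 - 32 * Y ^ 5 + 80 * Y ^ 4 - 80 * Y ^ 3 + 40 * Y ^ 2 - 10 * Y + 1 := by
  intro h
  obtain ⟨t, ht, rfl⟩ : ∃ t : ℤ, 0 ≤ t ∧ Y = t + 27041 := ⟨Y - 27041, by lia, by ring⟩
  set P : ℤ := (t + 27041) ^ 3 - 16 * (t + 27041) ^ 2 - 88 * (t + 27041) - 1448 with hP
  have hP1 : 0 < P - 1 := by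
    rw [hP]; ring_nf; positivity
  have hlt : X ^ 2 < P ^ 2 := by
    rw [h, hP, ← sub_pos]; ring_nf; positivity
  have hgt : (P - 1) ^ 2 < X ^ 2 := by
    rw [h, hP, ← sub_pos]; ring_nf; positivity
  have := lt_of_pow_lt_pow_left₀ 2 (by lia) hlt
  have := lt_of_pow_lt_pow_left₀ 2 hX.le hgt
  lia

theorem stmt_6 : ¬ ∃ (X Y : ℤ), 0 < X ∧ 0 < Y ∧
    X ^ 2 = Y ^ 6 - 32 * Y ^ 5 + 80 * Y ^ 4 - 80 * Y ^ 3 + 40 * Y ^ 2 - 10 * Y + 1 := by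
  rintro ⟨X, Y, hX, hY, h⟩
  rcases lt_or_ge Y 27041 with hlt | hge
  · obtain rfl | hY2 : Y = 1 ∨ 2 ≤ Y := by lia
    · norm_num at h
      exact hX.ne' h
    · lift X to ℕ using hX.le
      obtain ⟨n, rfl⟩ : ∃ n : ℕ, Y = n + 2 := ⟨(Y - 2).toNat, by lia⟩
      refine not_sextic_of_lt (n := n) (x := X) (by lia) ?_
      zify
      linear_combination h
  · exact not_sextic_of_le hX hge h
end

section
/- The equation X² = Y⁸ − 32Y⁵ + 80Y⁴ − 80Y³ + 40Y² − 10Y + 1 has no solutions in positive integers X, Y. -/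
theorem stmt_7 : ¬ ∃ (X Y : ℤ), 0 < X ∧ 0 < Y ∧
    X ^ 2 = Y ^ 8 - 32 * Y ^ 5 + 80 * Y ^ 4 - 80 * Y ^ 3 + 40 * Y ^ 2 - 10 * Y + 1 := by
  rintro ⟨X, Y, hX, hY, h⟩
  rcases lt_or_ge Y 43 with hlt | hge
  · have hsq : IsSquare
        (Y ^ 8 - 32 * Y ^ 5 + 80 * Y ^ 4 - 80 * Y ^ 3 + 40 * Y ^ 2 - 10 * Y + 1) :=
      ⟨X, by rw [← h, sq]⟩
    rcases (show Y = 1 ∨ 2 ≤ Y by lia) with rfl | h2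
    · norm_num at h
      lia
    · clear h
      interval_cases Y <;> norm_num at hsq
  · obtain ⟨t, rfl⟩ : ∃ t, Y = t + 43 := ⟨Y - 43, by ring⟩
    have ht : 0 ≤ t := by lia
    have hpos : 0 ≤ (t + 43) ^ 4 - 16 * (t + 43) + 39 := by
      ring_nf
      positivity
    have hlower : ((t + 43) ^ 4 - 16 * (t + 43) + 39) ^ 2 < X ^ 2 := by
      rw [h, ← sub_pos]
      ring_nf
      positivity
    have hupper : X ^ 2 < ((t + 43) ^ 4 - 16 * (t + 43) + 40) ^ 2 := by
      rw [h, ← sub_pos]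
      ring_nf
      positivity
    have hgt := lt_of_pow_lt_pow_left₀ 2 hX.le hlower
    have hlt := lt_of_pow_lt_pow_left₀ 2 (by lia) hupper
    lia
end

section
/- The equation X² = Y¹⁰ − 8Y⁶ + 12Y⁴ − 6Y² + 1 has no solutions in positive integers X, Y. -/
/-- A positive integer `Y` such that `Y ^ 2 - 1` is a square up to sign is equal to `1`. -/
theorem Int.eq_one_of_sq_sub_one_eq_sq_or_neg_sq {Y s : ℤ} (hY : 0 < Y)
    (h : Y ^ 2 - 1 = s ^ 2 ∨ Y ^ 2 - 1 = -s ^ 2) : Y = 1 := by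
  rcases h with h | h
  · have hlt : |s| < Y := abs_lt_of_sq_lt_sq (by linarith) hY.le
    nlinarith [sq_abs s, abs_nonneg s]
  · nlinarith [sq_nonneg s]

theorem stmt_8 : ¬ ∃ (X Y : ℤ), 0 < X ∧ 0 < Y ∧
    X ^ 2 = Y ^ 10 - 8 * Y ^ 6 + 12 * Y ^ 4 - 6 * Y ^ 2 + 1 := by
  rintro ⟨X, Y, hX, hY, h⟩
  have hcop : IsCoprime (Y ^ 2 - 1) (Y ^ 8 + Y ^ 6 - 7 * Y ^ 4 + 5 * Y ^ 2 - 1) :=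
    ⟨Y ^ 6 + 2 * Y ^ 4 - 5 * Y ^ 2, -1, by ring⟩
  have hmul : (Y ^ 2 - 1) * (Y ^ 8 + Y ^ 6 - 7 * Y ^ 4 + 5 * Y ^ 2 - 1) = X ^ 2 := by
    rw [h]; ring
  obtain ⟨s, hs⟩ := Int.sq_of_isCoprime hcop hmul
  obtain rfl := Int.eq_one_of_sq_sub_one_eq_sq_or_neg_sq hY hs
  norm_num at h
  exact hX.ne' h
end

section
/- The equation X² = Y¹⁰ − 32Y⁵ + 80Y⁴ − 80Y³ + 40Y² − 10Y + 1 has no solutions in positive integers X, Y. -/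
theorem sub_sq_ne_of_lt_forty : ∀ y ∈ Finset.Ico (2 : ℤ) 40, ∀ d ∈ Finset.Ico (1 : ℤ) 16,
    (y ^ 5 - d) ^ 2 ≠ y ^ 10 - (2 * y - 1) ^ 5 := by
  decide +kernel

theorem stmt_9 : ¬ ∃ (X Y : ℤ), 0 < X ∧ 0 < Y ∧
    X ^ 2 = Y ^ 10 - 32 * Y ^ 5 + 80 * Y ^ 4 - 80 * Y ^ 3 + 40 * Y ^ 2 - 10 * Y + 1 := by
  rintro ⟨X, Y, hX, hY, h⟩
  obtain rfl | hY2 : Y = 1 ∨ 2 ≤ Y := by omega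
  · norm_num at h
    omega
  have hpow : (0 : ℤ) < (2 * Y - 1) ^ 5 := pow_pos (by linarith) 5
  have h_eq : X ^ 2 = Y ^ 10 - (2 * Y - 1) ^ 5 := by rw [h]; ring
  have h_upper : X < Y ^ 5 := by
    refine lt_of_pow_lt_pow_left₀ 2 (by positivity) ?_
    calc X ^ 2 = Y ^ 10 - (2 * Y - 1) ^ 5 := h_eq
      _ < Y ^ 10 := sub_lt_self _ hpow
      _ = (Y ^ 5) ^ 2 := by ring
  have h_lower : Y ^ 5 - 16 < X := by
    refine lt_of_pow_lt_pow_left₀ 2 hX.le ?_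
    obtain ⟨t, rfl⟩ : ∃ t, Y = t + 2 := ⟨Y - 2, by ring⟩
    have ht : 0 ≤ t := by linarith
    rw [h, ← sub_pos]
    ring_nf
    positivity
  obtain hlt | hge := lt_or_ge Y 40
  · refine sub_sq_ne_of_lt_forty Y (Finset.mem_Ico.2 ⟨hY2, hlt⟩) (Y ^ 5 - X)
      (Finset.mem_Ico.2 ⟨by omega, by omega⟩) ?_
    rw [← h_eq]
    ring
  · have h_low : X < Y ^ 5 - 15 := by
      obtain ⟨t, rfl⟩ : ∃ t, Y = t + 40 := ⟨Y - 40, by ring⟩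
      have ht : 0 ≤ t := by linarith
      have hbase : 0 ≤ (t + 40) ^ 5 - 15 := by
        ring_nf
        positivity
      refine lt_of_pow_lt_pow_left₀ 2 hbase ?_
      rw [h, ← sub_pos]
      ring_nf
      positivity
    omega
end

section
/- The equation X² = Y¹⁴ − 32Y¹⁰ + 80Y⁸ − 80Y⁶ + 40Y⁴ − 10Y² + 1 has no solutions in positive integers X, Y. -/
/-- If a product of coprime integers is a square and one factor is positive, both are squares. -/
theorem exists_sq_of_isCoprime_of_mul_eq_sq {a b c : ℤ} (h : IsCoprime a b) (ha : 0 < a)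
    (heq : a * b = c ^ 2) : (∃ r, a = r ^ 2) ∧ ∃ s, b = s ^ 2 := by
  have hb : 0 ≤ b := by
    by_contra! hb
    nlinarith [mul_neg_of_pos_of_neg ha hb, sq_nonneg c]
  constructor
  · obtain ⟨r, hr | hr⟩ := Int.sq_of_isCoprime h heq
    · exact ⟨r, hr⟩
    · nlinarith [sq_nonneg r]
  · obtain ⟨s, hs | hs⟩ := Int.sq_of_isCoprime h.symm ((mul_comm b a).trans heq)
    · exact ⟨s, hs⟩
    · exact ⟨0, by nlinarith [sq_nonneg s]⟩

/-- The cofactor of `z - 1` in `z ^ 7 - (2 * z - 1) ^ 5`. -/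
def cofactor {R : Type*} [CommRing R] (z : R) : R :=
  z ^ 6 + z ^ 5 - 31 * z ^ 4 + 49 * z ^ 3 - 31 * z ^ 2 + 9 * z - 1

theorem cofactor_intCast {R : Type*} [CommRing R] (z : ℤ) :
    ((cofactor z : ℤ) : R) = cofactor (z : R) := by
  simp [cofactor]

theorem exists_cofactor_eq (z : ℤ) : ∃ k, cofactor z = (z - 1) * k - 3 :=
  ⟨z ^ 5 + 2 * z ^ 4 - 29 * z ^ 3 + 20 * z ^ 2 - 11 * z - 2, by unfold cofactor; ring⟩

/-- The factor `y ^ 2 - 1` and its cofactor are both three times a square. -/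
theorem exists_three_mul_sq {x y : ℤ} (hy : 1 < y)
    (h : x ^ 2 = (y ^ 2 - 1) * cofactor (y ^ 2)) :
    (∃ a, y ^ 2 - 1 = 3 * a ^ 2) ∧ ∃ b, cofactor (y ^ 2) = 3 * b ^ 2 := by
  obtain ⟨k, hk⟩ := exists_cofactor_eq (y ^ 2)
  by_cases h3 : (3 : ℤ) ∣ y ^ 2 - 1
  · obtain ⟨d, hd⟩ := h3
    rw [hd] at hk h
    have hx : (3 : ℤ) ∣ x :=
      Int.prime_three.dvd_of_dvd_pow ⟨d * cofactor (y ^ 2), by rw [h]; ring⟩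
    obtain ⟨w, rfl⟩ := hx
    have hq : cofactor (y ^ 2) = 3 * (d * k - 1) := by rw [hk]; ring
    have hw : d * (d * k - 1) = w ^ 2 := by rw [hq] at h; linarith
    obtain ⟨⟨r, hr⟩, s, hs⟩ := exists_sq_of_isCoprime_of_mul_eq_sq
      ⟨k, -1, by ring⟩ (by nlinarith) hw
    exact ⟨⟨r, by rw [hd, hr]⟩, s, by rw [hq, hs]⟩
  · have h13 : IsCoprime (y ^ 2 - 1) 3 :=
      ((Int.prime_three.coprime_iff_not_dvd).2 h3).symm
    have hc : IsCoprime (y ^ 2 - 1) (cofactor (y ^ 2)) := by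
      obtain ⟨u, v, huv⟩ := h13
      exact ⟨u + v * k, -v, by rw [hk]; linear_combination huv⟩
    obtain ⟨⟨r, hr⟩, -⟩ := exists_sq_of_isCoprime_of_mul_eq_sq hc (by nlinarith) h.symm
    have hlt : |r| < y := abs_lt_of_sq_lt_sq (by linarith) (by linarith)
    nlinarith [sq_abs r, abs_nonneg r]

theorem even_of_three_mul_sq {y a b : ℤ} (ha : y ^ 2 - 1 = 3 * a ^ 2)
    (hb : cofactor (y ^ 2) = 3 * b ^ 2) : Even y := by
  by_contra hy
  obtain ⟨m, rfl⟩ := Int.not_even_iff_odd.1 hy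
  have key : ∀ m a b : ZMod 4, (2 * m + 1) ^ 2 - 1 = 3 * a ^ 2 →
      cofactor ((2 * m + 1) ^ 2) ≠ 3 * b ^ 2 := by
    unfold cofactor; decide
  refine key m a b ?_ ?_
  · exact_mod_cast congrArg (Int.cast : ℤ → ZMod 4) ha
  · have := congrArg (Int.cast : ℤ → ZMod 4) hb
    rw [cofactor_intCast] at this
    exact_mod_cast this

theorem exists_sub_one_add_one {y a : ℤ} (hy : 1 < y) (he : Even y)
    (ha : y ^ 2 - 1 = 3 * a ^ 2) : ∃ r s, y - 1 = r ^ 2 ∧ y + 1 = 3 * s ^ 2 := by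
  obtain ⟨m, rfl⟩ := he
  have hmod : 3 ∣ m + m - 1 ∨ 3 ∣ m + m + 1 :=
    Int.prime_three.dvd_or_dvd ⟨a ^ 2, by linear_combination ha⟩
  rcases hmod with ⟨u, hu⟩ | ⟨u, hu⟩
  · have hc : IsCoprime (m + m + 1) u :=
      ⟨1 - m, 3 * m, by linear_combination -m * hu⟩
    obtain ⟨⟨s, hs⟩, -⟩ := exists_sq_of_isCoprime_of_mul_eq_sq (c := a) hc (by linarith)
      (mul_left_cancel₀ three_ne_zero (by linear_combination ha - (m + m + 1) * hu))
    have key : ∀ s : ZMod 3, s ^ 2 ≠ 2 := by decide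
    refine absurd ?_ (key s)
    have hs' : s ^ 2 = 3 * u + 2 := by linarith
    have := congrArg (Int.cast : ℤ → ZMod 3) hs'
    push_cast at this
    rw [this, show (3 : ZMod 3) = 0 from rfl, zero_mul, zero_add]
  · have hc : IsCoprime (m + m - 1) u :=
      ⟨-m - 1, 3 * m, by linear_combination -m * hu⟩
    obtain ⟨⟨r, hr⟩, s, hs⟩ := exists_sq_of_isCoprime_of_mul_eq_sq (c := a) hc (by linarith)
      (mul_left_cancel₀ three_ne_zero (by linear_combination ha - (m + m - 1) * hu))
    exact ⟨r, s, hr, by rw [hu, hs]⟩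

theorem cofactor_ne_three_mul_sq {y r s : ℤ} (hr : y - 1 = r ^ 2) (hs : y + 1 = 3 * s ^ 2)
    (b : ℤ) : cofactor (y ^ 2) ≠ 3 * b ^ 2 := by
  intro hb
  have key : ∀ y : ZMod 11, (∃ r, y - 1 = r ^ 2) → (∃ s, y + 1 = 3 * s ^ 2) →
      ¬ ∃ b, cofactor (y ^ 2) = 3 * b ^ 2 := by
    unfold cofactor; decide
  refine key y ⟨r, ?_⟩ ⟨s, ?_⟩ ⟨b, ?_⟩
  · exact_mod_cast congrArg (Int.cast : ℤ → ZMod 11) hr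
  · exact_mod_cast congrArg (Int.cast : ℤ → ZMod 11) hs
  · have := congrArg (Int.cast : ℤ → ZMod 11) hb
    rw [cofactor_intCast] at this
    exact_mod_cast this

theorem stmt_10 : ¬ ∃ (X Y : ℤ), 0 < X ∧ 0 < Y ∧
    X ^ 2 = Y ^ 14 - 32 * Y ^ 10 + 80 * Y ^ 8 - 80 * Y ^ 6 + 40 * Y ^ 4 - 10 * Y ^ 2 + 1 := by
  rintro ⟨X, Y, hX, hY, h⟩
  have hfac : X ^ 2 = (Y ^ 2 - 1) * cofactor (Y ^ 2) := by
    rw [h]; unfold cofactor; ring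
  have hY1 : 1 < Y := by
    refine lt_of_le_of_ne hY ?_
    rintro rfl
    norm_num at hfac
    omega
  obtain ⟨⟨a, ha⟩, b, hb⟩ := exists_three_mul_sq hY1 hfac
  obtain ⟨r, s, hr, hs⟩ := exists_sub_one_add_one hY1 (even_of_three_mul_sq ha hb) ha
  exact cofactor_ne_three_mul_sq hr hs b hb
end

section
/- The equation X² = Y¹⁸ − 32Y¹⁰ + 80Y⁸ − 80Y⁶ + 40Y⁴ − 10Y² + 1 has no solutions in positive integers X, Y. -/
theorem stmt_11 : ¬ ∃ (X Y : ℤ), 0 < X ∧ 0 < Y ∧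
    X ^ 2 = Y ^ 18 - 32 * Y ^ 10 + 80 * Y ^ 8 - 80 * Y ^ 6 + 40 * Y ^ 4 - 10 * Y ^ 2 + 1 := by
  rintro ⟨X, Y, hX, hY, h⟩
  rcases lt_or_ge Y 41 with hlt | hge
  · have hs : IsSquare (Y ^ 18 - 32 * Y ^ 10 + 80 * Y ^ 8 - 80 * Y ^ 6 + 40 * Y ^ 4
        - 10 * Y ^ 2 + 1) := ⟨X, by rw [← h, sq]⟩
    obtain rfl | hY1 : Y = 1 ∨ 2 ≤ Y := by lia
    · norm_num at h
      exact hX.ne' h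
    · clear h hX hY
      interval_cases Y <;> norm_num at hs
  · -- For large `Y`, `X` lies strictly between `Y ^ 9 - 16 * Y` and its successor.
    obtain ⟨t, ht, rfl⟩ : ∃ t : ℤ, 0 ≤ t ∧ Y = t + 41 := ⟨Y - 41, by lia, by ring⟩
    have hpos : 0 ≤ (t + 41) ^ 9 - 16 * (t + 41) := by
      ring_nf
      positivity
    have hlow : (t + 41) ^ 9 - 16 * (t + 41) < X := by
      refine lt_of_pow_lt_pow_left₀ 2 hX.le ?_
      rw [h, ← sub_pos]
      ring_nf
      positivity
    have hupp : X < (t + 41) ^ 9 - 16 * (t + 41) + 1 := by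
      refine lt_of_pow_lt_pow_left₀ 2 (by lia) ?_
      rw [h, ← sub_pos]
      ring_nf
      positivity
    lia
end

section
/- Let k be an integer with k > 1, let x, y, z be positive integers with z odd satisfying x² + (2k−1)^y = k^z, and let d be a positive divisor of 2k−1. Then the Jacobi symbol (2/d) equals 1; in particular d ≡ 1 (mod 8) or d ≡ −1 (mod 8). -/
/-- If some odd power of `2` times a square is `1` modulo `d`, then `(2 / d) = 1`. -/
theorem jacobiSym_two_eq_one_of_modEq {z d : ℕ} {x : ℤ} (hz : Odd z)
    (h : 2 ^ z * x ^ 2 ≡ 1 [ZMOD d]) : jacobiSym 2 d = 1 := by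
  have hJ : jacobiSym 2 d ^ z * jacobiSym x d ^ 2 = 1 := by
    rw [← jacobiSym.pow_left, ← jacobiSym.pow_left, ← jacobiSym.mul_left,
      jacobiSym.mod_left' h, jacobiSym.one_left]
  rcases jacobiSym.trichotomy 2 d with h2 | h2 | h2
  · rw [h2, zero_pow hz.pos.ne', zero_mul] at hJ
    exact absurd hJ zero_ne_one
  · exact h2
  · rw [h2, hz.neg_one_pow] at hJ
    nlinarith [sq_nonneg (jacobiSym x d)]

theorem mod_eight_of_jacobiSym_two_eq_one {d : ℕ} (hd : Odd d) (h : jacobiSym 2 d = 1) :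
    d % 8 = 1 ∨ d % 8 = 7 := by
  rw [jacobiSym.at_two hd, ZMod.χ₈_nat_eq_if_mod_eight] at h
  have h_two : d % 2 ≠ 0 := by grind
  by_contra hne
  rw [if_neg h_two, if_neg hne] at h
  norm_num at h

theorem stmt_16 (k : ℤ) (hk : 1 < k)
    (x y z : ℕ) (hx : 0 < x) (hy : 0 < y) (hz : 0 < z) (hzodd : Odd z)
    (heq : (x : ℤ) ^ 2 + (2 * k - 1) ^ y = k ^ z)
    (d : ℕ) (hd : 0 < d) (hdvd : (d : ℤ) ∣ 2 * k - 1) :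
    jacobiSym 2 d = 1 ∧ (d % 8 = 1 ∨ d % 8 = 7) := by
  have hodd : Odd d := by
    rw [← Nat.not_even_iff_odd, even_iff_two_dvd]
    intro h
    have h_two : (2 : ℤ) ∣ 2 * k - 1 := (Int.natCast_dvd_natCast.mpr h).trans hdvd
    lia
  have hk_two : 2 * k ≡ 1 [ZMOD d] := (Int.modEq_iff_dvd.mpr hdvd).symm
  have hx_sq : (x : ℤ) ^ 2 ≡ k ^ z [ZMOD d] := by
    refine Int.modEq_iff_dvd.mpr ?_
    rw [← heq, add_sub_cancel_left]
    exact dvd_pow hdvd hy.ne'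
  have hmod : 2 ^ z * (x : ℤ) ^ 2 ≡ 1 [ZMOD d] := by
    calc 2 ^ z * (x : ℤ) ^ 2 ≡ 2 ^ z * k ^ z [ZMOD d] := hx_sq.mul_left _
      _ = (2 * k) ^ z := (mul_pow 2 k z).symm
      _ ≡ 1 ^ z [ZMOD d] := hk_two.pow z
      _ = 1 := one_pow z
  have hJ := jacobiSym_two_eq_one_of_modEq hzodd hmod
  exact ⟨hJ, mod_eight_of_jacobiSym_two_eq_one hodd hJ⟩
end

section
/- The equation x² + 1471³ = 736^z has no solutions in positive integers x, z. -/
/-- An integer congruent mod `n` to an `a` with Jacobi symbol `-1` is not a square. -/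
theorem sq_ne_of_modEq_of_jacobiSym {n : ℕ} {a b : ℤ} (h : jacobiSym a n = -1)
    (hb : b ≡ a [ZMOD n]) (x : ℤ) : x ^ 2 ≠ b := by
  intro hx
  refine ZMod.nonsquare_of_jacobiSym_eq_neg_one h ⟨(x : ZMod n), ?_⟩
  rw [← (ZMod.intCast_eq_intCast_iff b a n).2 hb, ← hx]
  push_cast
  ring

/-- If `k ^ m ≡ 1` mod `n` and `k ^ r - d` has Jacobi symbol `-1` mod `n`, then
`x ^ 2 + d = k ^ z` has no solution with `z ≡ r` mod `m`. -/
theorem sq_add_ne_pow_of_jacobiSym {n m r z : ℕ} {k d : ℤ} (hk : k ^ m ≡ 1 [ZMOD n])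
    (h : jacobiSym (k ^ r - d) n = -1) (hz : z % m = r) (x : ℤ) : x ^ 2 + d ≠ k ^ z := by
  intro hx
  refine sq_ne_of_modEq_of_jacobiSym h (b := k ^ z - d) ?_ x (by linarith)
  refine Int.ModEq.sub_right d ?_
  calc k ^ z = (k ^ m) ^ (z / m) * k ^ r := by
        rw [← pow_mul, ← pow_add, ← hz, Nat.div_add_mod]
    _ ≡ 1 ^ (z / m) * k ^ r [ZMOD n] := (hk.pow _).mul_right _
    _ = k ^ r := by rw [one_pow, one_mul]

theorem stmt_17 : ¬ ∃ (x z : ℕ), 0 < x ∧ 0 < z ∧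
    (x : ℤ) ^ 2 + 1471 ^ 3 = 736 ^ z := by
  rintro ⟨x, z, -, -, h⟩
  have hcases : z % 2 = 0 ∨ z % 3 = 0 ∨ z % 3 = 2 ∨ z % 6 = 1 := by omega
  rcases hcases with hz | hz | hz | hz
  · exact sq_add_ne_pow_of_jacobiSym (n := 11) (by decide) (by norm_num) hz x h
  · exact sq_add_ne_pow_of_jacobiSym (n := 180811) (by decide) (by norm_num) hz x h
  · exact sq_add_ne_pow_of_jacobiSym (n := 180811) (by decide) (by norm_num) hz x h
  · exact sq_add_ne_pow_of_jacobiSym (n := 540961) (by decide) (by norm_num) hz x h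
end

section
/- The equation x² + 1471⁵ = 736^z has no solutions in positive integers x, z. -/
/-- Modulo `67` we have `736 ≡ -1`, and `-1 - 1471 ^ 5 ≡ 2 * 11 ^ 2` is not a square. -/
theorem sq_add_ne_pow_of_odd (x : ℤ) {z : ℕ} (hz : Odd z) :
    x ^ 2 + 1471 ^ 5 ≠ 736 ^ z := by
  intro h
  have h67 := congrArg (Int.cast : ℤ → ZMod 67) h
  push_cast at h67
  rw [show (736 : ZMod 67) = -1 by decide, hz.neg_one_pow] at h67
  generalize (x : ZMod 67) = t at h67
  revert t
  decide

/-- For even exponents, `1471 ^ 5` factors as `(736 ^ m - x) * (736 ^ m + x)`. -/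
theorem sq_add_ne_pow_two_mul (x m : ℕ) :
    (x : ℤ) ^ 2 + 1471 ^ 5 ≠ 736 ^ (2 * m) := by
  intro h
  have hp : Nat.Prime 1471 := by norm_num
  have hlt : (x : ℤ) < 736 ^ m := by
    refine lt_of_pow_lt_pow_left₀ 2 (by positivity) ?_
    rw [← pow_mul, mul_comm m 2, ← h]
    norm_num
  obtain ⟨a, ha⟩ := Int.eq_ofNat_of_zero_le (sub_pos.2 hlt).le
  have hx : (736 : ℤ) ^ m = a + x := by linarith
  have hmul : a * (a + 2 * x) = 1471 ^ 5 := by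
    rw [mul_comm 2 m, pow_mul, hx] at h
    zify
    linarith
  have hsum : a + (a + 2 * x) = 2 * 736 ^ m := by
    zify
    rw [hx]
    ring
  generalize a + 2 * x = b at hmul hsum
  obtain ⟨i, hi, rfl⟩ := (Nat.dvd_prime_pow hp).1 (Dvd.intro _ hmul)
  have hb : b = 1471 ^ (5 - i) := by
    apply Nat.eq_of_mul_eq_mul_left (pow_pos hp.pos i)
    rw [hmul, ← pow_add, Nat.add_sub_cancel' hi]
  subst hb
  obtain rfl | rfl | ⟨n, rfl⟩ : m = 0 ∨ m = 1 ∨ ∃ n, m = n + 2 := by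
    rcases m with _ | _ | n <;> simp
  · interval_cases i <;> norm_num at hsum
  · interval_cases i <;> norm_num at hsum
  · rw [pow_add] at hsum
    generalize 736 ^ n = c at hsum
    interval_cases i <;> norm_num at hsum <;> omega

theorem stmt_18 : ¬ ∃ (x z : ℕ), 0 < x ∧ 0 < z ∧
    (x : ℤ) ^ 2 + 1471 ^ 5 = 736 ^ z := by
  rintro ⟨x, z, -, -, h⟩
  rcases Nat.even_or_odd' z with ⟨m, rfl | rfl⟩
  · exact sq_add_ne_pow_two_mul x m h
  · exact sq_add_ne_pow_of_odd x (odd_two_mul_add_one m) h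
end
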